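/- arXiv:0709.0326 — 11 statements merged into one kernel-verified Lean document; each statement's English description precedes it below -/
import Mathlib

section
/- In ℤS₄, for every integer i ≥ 7, m_i = 14·m_{i-2} − 49·m_{i-4} + 36·m_{i-6}, where m_i := L₂^i + L₃^i + L₄^i. -/
open MonoidAlgebra

noncomputable def L2 : MonoidAlgebra ℤ (Equiv.Perm (Fin 4)) := single (Equiv.swap 0 1) 1
noncomputable def L3 : MonoidAlgebra ℤ (Equiv.Perm (Fin 4)) :=
  single (Equiv.swap 0 2) 1 + single (Equiv.swap 1 2) 1
noncomputable def L4 : MonoidAlgebra ℤ (Equiv.Perm (Fin 4)) :=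
  single (Equiv.swap 0 3) 1 + single (Equiv.swap 1 3) 1 + single (Equiv.swap 2 3) 1

/-- The coefficient of the group element `w` in `h ∈ ℤS₄`. -/
def coeff (h : MonoidAlgebra ℤ (Equiv.Perm (Fin 4))) (w : Equiv.Perm (Fin 4)) : ℤ :=
  (h.coeff : (Equiv.Perm (Fin 4)) →₀ ℤ) w

/-- `s₁ = (1 2)` -/
def s1 : Equiv.Perm (Fin 4) := Equiv.swap 0 1
/-- `s₁₂ = (1 2 3)`, a 3-cycle -/
def s12 : Equiv.Perm (Fin 4) := Equiv.swap 0 1 * Equiv.swap 1 2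
/-- `s₁₃ = (1 2)(3 4)` -/
def s13 : Equiv.Perm (Fin 4) := Equiv.swap 0 1 * Equiv.swap 2 3
/-- `s₁₂₃ = (1 2 3 4)`, a 4-cycle -/
def s123 : Equiv.Perm (Fin 4) := Equiv.swap 0 1 * Equiv.swap 1 2 * Equiv.swap 2 3

/-- `m_i = m_{(i)}(L₁,L₂,L₃,L₄)` (recall `L₁ = 0`). -/
noncomputable def mI (i : ℕ) : MonoidAlgebra ℤ (Equiv.Perm (Fin 4)) := L2 ^ i + L3 ^ i + L4 ^ i


/-- Function on `S₄` that is constant on the `S₃`-conjugacy classes. -/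
def clF (x0 x1 x2 x3 x4 x5 x6 : ℤ) (g : Equiv.Perm (Fin 4)) : ℤ :=
  let k : ℕ := (if g 0 = 0 then 1 else 0) + (if g 1 = 1 then 1 else 0) +
    (if g 2 = 2 then 1 else 0)
  if g 3 = 3 then (if k = 3 then x0 else if k = 1 then x1 else x2)
  else if k = 2 then x3 else if k = 1 then x4 else if g (g 0) = 0 then x5 else x6

def mul3 (f : Equiv.Perm (Fin 4) → ℤ) (g : Equiv.Perm (Fin 4)) : ℤ :=
  f (Equiv.swap 0 2 * g) + f (Equiv.swap 1 2 * g)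

def mul4 (f : Equiv.Perm (Fin 4) → ℤ) (g : Equiv.Perm (Fin 4)) : ℤ :=
  f (Equiv.swap 0 3 * g) + f (Equiv.swap 1 3 * g) + f (Equiv.swap 2 3 * g)

lemma L3_step (x : MonoidAlgebra ℤ (Equiv.Perm (Fin 4))) (f : Equiv.Perm (Fin 4) → ℤ)
    (h : ∀ g, x.coeff g = f g) (g : Equiv.Perm (Fin 4)) : (L3 * x).coeff g = mul3 f g := by
  simp [L3, add_mul, mul3, h]

lemma L4_step (x : MonoidAlgebra ℤ (Equiv.Perm (Fin 4))) (f f' : Equiv.Perm (Fin 4) → ℤ)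
    (h : ∀ g, x.coeff g = f g) (h' : ∀ g, mul4 f g = f' g)
    (g : Equiv.Perm (Fin 4)) : (L4 * x).coeff g = f' g := by
  rw [← h']
  simp [L4, add_mul, mul4, h]

lemma one_F (g : Equiv.Perm (Fin 4)) :
    (1 : MonoidAlgebra ℤ (Equiv.Perm (Fin 4))).coeff g = clF 1 0 0 0 0 0 0 g := by
  have h : ∀ g : Equiv.Perm (Fin 4), (if g = 1 then (1 : ℤ) else 0) = clF 1 0 0 0 0 0 0 g := by
    decide +kernel
  rw [← h, MonoidAlgebra.one_def, MonoidAlgebra.coeff_single, Finsupp.single_apply]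
  simp [eq_comm]

lemma L2_rel : L2 ^ 2 = 1 := by
  simp [L2, pow_two, MonoidAlgebra.one_def, MonoidAlgebra.single_mul_single]

lemma L3_rel : L3 ^ 4 + (4 : ℤ) • (1 : MonoidAlgebra ℤ (Equiv.Perm (Fin 4))) = (5 : ℤ) • L3 ^ 2 := by
  have h1 := L3_step _ _ one_F
  have h2 := L3_step _ _ h1
  have h3 := L3_step _ _ h2
  have h4 := L3_step _ _ h3
  have e2 : L3 ^ 2 = L3 * (L3 * 1) := by noncomm_ring
  have e4 : L3 ^ 4 = L3 * (L3 * (L3 * (L3 * 1))) := by noncomm_ring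
  have key : ∀ g, mul3 (mul3 (mul3 (mul3 (clF 1 0 0 0 0 0 0)))) g + 4 * clF 1 0 0 0 0 0 0 g
      = 5 * mul3 (mul3 (clF 1 0 0 0 0 0 0)) g := by decide +kernel
  rw [e2, e4]
  ext g
  have := key g
  rw [← h4, ← h2, ← one_F] at this
  simp only [MonoidAlgebra.coeff_add, MonoidAlgebra.coeff_smul, Finsupp.add_apply,
    Finsupp.smul_apply, smul_eq_mul]
  exact this

lemma L4_rel : L4 ^ 7 + (49 : ℤ) • L4 ^ 3 = (14 : ℤ) • L4 ^ 5 + (36 : ℤ) • L4 := by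
  have h1 := L4_step _ _ (clF 0 0 0 1 0 0 0) one_F (by decide +kernel)
  have h2 := L4_step _ _ (clF 3 0 0 0 1 0 0) h1 (by decide +kernel)
  have h3 := L4_step _ _ (clF 0 2 0 5 0 0 1) h2 (by decide +kernel)
  have h4 := L4_step _ _ (clF 15 0 3 0 8 4 0) h3 (by decide +kernel)
  have h5 := L4_step _ _ (clF 0 20 0 31 0 0 15) h4 (by decide +kernel)
  have h6 := L4_step _ _ (clF 93 0 45 0 66 50 0) h5 (by decide +kernel)
  have h7 := L4_step _ _ (clF 0 182 0 225 0 0 161) h6 (by decide +kernel)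
  have key : ∀ g, clF 0 182 0 225 0 0 161 g + 49 * clF 0 2 0 5 0 0 1 g
      = 14 * clF 0 20 0 31 0 0 15 g + 36 * clF 0 0 0 1 0 0 0 g := by decide +kernel
  have e3 : L4 ^ 3 = L4 * (L4 * (L4 * 1)) := by noncomm_ring
  have e5 : L4 ^ 5 = L4 * (L4 * (L4 * (L4 * (L4 * 1)))) := by noncomm_ring
  have e7 : L4 ^ 7 = L4 * (L4 * (L4 * (L4 * (L4 * (L4 * (L4 * 1)))))) := by noncomm_ring
  rw [← e3] at h3
  rw [← e5] at h5
  rw [← e7] at h7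
  rw [mul_one] at h1
  ext g
  have := key g
  rw [← h7, ← h5, ← h3, ← h1] at this
  simp only [MonoidAlgebra.coeff_add, MonoidAlgebra.coeff_smul, Finsupp.add_apply,
    Finsupp.smul_apply, smul_eq_mul]
  exact this

theorem mI_recursion (i : ℕ) (hi : 7 ≤ i) :
    mI i = 14 * mI (i - 2) - 49 * mI (i - 4) + 36 * mI (i - 6) := by
  obtain ⟨j, rfl⟩ := Nat.exists_eq_add_of_le hi
  have a1 : 7 + j - 2 = 5 + j := by omega
  have a2 : 7 + j - 4 = 3 + j := by omega
  have a3 : 7 + j - 6 = 1 + j := by omega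
  rw [a1, a2, a3]
  have r2 : L2 ^ 7 = 14 * L2 ^ 5 - 49 * L2 ^ 3 + 36 * L2 := by
    have e3 : L2 ^ 3 = L2 := by rw [pow_succ, L2_rel, one_mul]
    have e5 : L2 ^ 5 = L2 := by rw [show 5 = 3 + 2 from rfl, pow_add, L2_rel, mul_one, e3]
    have e7 : L2 ^ 7 = L2 := by rw [show 7 = 5 + 2 from rfl, pow_add, L2_rel, mul_one, e5]
    rw [e3, e5, e7]; noncomm_ring
  have r3 : L3 ^ 7 = 14 * L3 ^ 5 - 49 * L3 ^ 3 + 36 * L3 := by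
    have h : L3 ^ 4 = 5 * L3 ^ 2 - 4 := by
      have := eq_sub_of_add_eq L3_rel
      rw [this, zsmul_eq_mul, zsmul_eq_mul, mul_one]; norm_cast
    have e5 : L3 ^ 5 = 5 * L3 ^ 3 - 4 * L3 := by
      rw [pow_succ, h]; noncomm_ring
    have e7 : L3 ^ 7 = 5 * L3 ^ 5 - 4 * L3 ^ 3 := by
      rw [show 7 = 4 + 3 from rfl, pow_add, h]; noncomm_ring
    rw [e7, e5]; noncomm_ring
  have r4 : L4 ^ 7 = 14 * L4 ^ 5 - 49 * L4 ^ 3 + 36 * L4 := by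
    have := eq_sub_of_add_eq L4_rel
    rw [this]; simp only [zsmul_eq_mul, Int.cast_ofNat]; abel
  simp only [mI, pow_add, r2, r3, r4, pow_one]
  noncomm_ring
end

section
/- In ℤS₄, for every integer i ≥ 6, m_{i,i} = 8·m_{i-1,i-1} − 5·m_{i-2,i-2} − 50·m_{i-3,i-3} + 36·m_{i-4,i-4} + 72·m_{i-5,i-5}, where m_{i,i} := L₂^iL₃^i + L₂^iL₄^i + L₃^iL₄^i. -/
open MonoidAlgebra

/-- `m_{i,i} = m_{(i,i)}(L₁,L₂,L₃,L₄)` (recall `L₁ = 0`). -/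
noncomputable def mII (i : ℕ) : MonoidAlgebra ℤ (Equiv.Perm (Fin 4)) :=
  L2 ^ i * L3 ^ i + L2 ^ i * L4 ^ i + L3 ^ i * L4 ^ i

set_option linter.unusedSimpArgs false
set_option maxHeartbeats 1000000

theorem relA {R : Type*} [Ring R] (a b c : R) (h1 : a*a=1) (h2 : b*b=1) (h3 : c*c=1) (h4 : c*a=a*c)
    (h5 : b*(a*b)=a*(b*a)) (h6 : c*(b*c)=b*(c*b)) (X : R) (hX : X = (a*b) + (b*a)) :
    (X - (2:ℤ) • (1:R))*(X - (-1:ℤ) • (1:R)) = 0 := by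
  have h7 : c*(b*(a*c)) = b*(c*(b*a)) := by
    rw [← h4, ← mul_assoc b, ← mul_assoc c, h6]; simp only [mul_assoc]
  have g1 : ∀ x : R, a*(a*x) = x := by
    intro x; have := congrArg (· * x) h1; simpa only [mul_assoc, one_mul] using this
  have g2 : ∀ x : R, b*(b*x) = x := by
    intro x; have := congrArg (· * x) h2; simpa only [mul_assoc, one_mul] using this
  have g3 : ∀ x : R, c*(c*x) = x := by
    intro x; have := congrArg (· * x) h3; simpa only [mul_assoc, one_mul] using this
  have g4 : ∀ x : R, c*(a*x) = a*(c*x) := by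
    intro x; have := congrArg (· * x) h4; simpa only [mul_assoc, one_mul] using this
  have g5 : ∀ x : R, b*(a*(b*x)) = a*(b*(a*x)) := by
    intro x; have := congrArg (· * x) h5; simpa only [mul_assoc, one_mul] using this
  have g6 : ∀ x : R, c*(b*(c*x)) = b*(c*(b*x)) := by
    intro x; have := congrArg (· * x) h6; simpa only [mul_assoc, one_mul] using this
  have g7 : ∀ x : R, c*(b*(a*(c*x))) = b*(c*(b*(a*x))) := by
    intro x; have := congrArg (· * x) h7; simpa only [mul_assoc, one_mul] using this
  have e0 : (X - (2:ℤ) • (1:R)) = (-2:ℤ) • (1:R) + (a*b) + (b*a) := by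
    rw [hX]
    try simp only [zero_smul, mul_add, add_mul, mul_sub, sub_mul, smul_mul_assoc, mul_smul_comm, mul_assoc, one_mul, mul_one, zero_mul, mul_zero, sub_zero, h1,h2,h3,h4,h5,h6,h7,g1,g2,g3,g4,g5,g6,g7]
    try abel
  have e1 : (X - (2:ℤ) • (1:R))*(X - (-1:ℤ) • (1:R)) = 0 := by
    rw [e0, hX]
    try simp only [zero_smul, mul_add, add_mul, mul_sub, sub_mul, smul_mul_assoc, mul_smul_comm, mul_assoc, one_mul, mul_one, zero_mul, mul_zero, sub_zero, h1,h2,h3,h4,h5,h6,h7,g1,g2,g3,g4,g5,g6,g7]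
    try abel
  exact e1

theorem relB {R : Type*} [Ring R] (a b c : R) (h1 : a*a=1) (h2 : b*b=1) (h3 : c*c=1) (h4 : c*a=a*c)
    (h5 : b*(a*b)=a*(b*a)) (h6 : c*(b*c)=b*(c*b)) (X : R) (hX : X = (a*b*c*b) + (a*c) + (b*c*b*a)) :
    (X - (0:ℤ) • (1:R))*(X - (3:ℤ) • (1:R))*(X - (2:ℤ) • (1:R))*(X - (-1:ℤ) • (1:R))*(X - (-2:ℤ) • (1:R)) = 0 := by
  have h7 : c*(b*(a*c)) = b*(c*(b*a)) := by
    rw [← h4, ← mul_assoc b, ← mul_assoc c, h6]; simp only [mul_assoc]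
  have g1 : ∀ x : R, a*(a*x) = x := by
    intro x; have := congrArg (· * x) h1; simpa only [mul_assoc, one_mul] using this
  have g2 : ∀ x : R, b*(b*x) = x := by
    intro x; have := congrArg (· * x) h2; simpa only [mul_assoc, one_mul] using this
  have g3 : ∀ x : R, c*(c*x) = x := by
    intro x; have := congrArg (· * x) h3; simpa only [mul_assoc, one_mul] using this
  have g4 : ∀ x : R, c*(a*x) = a*(c*x) := by
    intro x; have := congrArg (· * x) h4; simpa only [mul_assoc, one_mul] using this
  have g5 : ∀ x : R, b*(a*(b*x)) = a*(b*(a*x)) := by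
    intro x; have := congrArg (· * x) h5; simpa only [mul_assoc, one_mul] using this
  have g6 : ∀ x : R, c*(b*(c*x)) = b*(c*(b*x)) := by
    intro x; have := congrArg (· * x) h6; simpa only [mul_assoc, one_mul] using this
  have g7 : ∀ x : R, c*(b*(a*(c*x))) = b*(c*(b*(a*x))) := by
    intro x; have := congrArg (· * x) h7; simpa only [mul_assoc, one_mul] using this
  have e0 : (X - (0:ℤ) • (1:R)) = (a*b*c*b) + (a*c) + (b*c*b*a) := by
    rw [hX]
    try simp only [zero_smul, mul_add, add_mul, mul_sub, sub_mul, smul_mul_assoc, mul_smul_comm, mul_assoc, one_mul, mul_one, zero_mul, mul_zero, sub_zero, h1,h2,h3,h4,h5,h6,h7,g1,g2,g3,g4,g5,g6,g7]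
    try abel
  have e1 : (X - (0:ℤ) • (1:R))*(X - (3:ℤ) • (1:R)) = (3:ℤ) • (1:R) + (a*b*a*c) + (-2:ℤ) • (a*b*c*b) + (-3:ℤ) • (a*c) + (a*c*b*a) + (b*c) + (-2:ℤ) • (b*c*b*a) + (c*b) := by
    rw [e0, hX]
    try simp only [zero_smul, mul_add, add_mul, mul_sub, sub_mul, smul_mul_assoc, mul_smul_comm, mul_assoc, one_mul, mul_one, zero_mul, mul_zero, sub_zero, h1,h2,h3,h4,h5,h6,h7,g1,g2,g3,g4,g5,g6,g7]
    try abel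
  have e2 : (X - (0:ℤ) • (1:R))*(X - (3:ℤ) • (1:R))*(X - (2:ℤ) • (1:R)) = (-13:ℤ) • (1:R) + (2:ℤ) • (a*b) + (-4:ℤ) • (a*b*a*c) + (a*b*a*c*b*a) + (6:ℤ) • (a*b*c*b) + (11:ℤ) • (a*c) + (-4:ℤ) • (a*c*b*a) + (2:ℤ) • (b*a) + (b*a*c*b) + (-4:ℤ) • (b*c) + (6:ℤ) • (b*c*b*a) + (-4:ℤ) • (c*b) := by
    rw [e1, hX]
    try simp only [zero_smul, mul_add, add_mul, mul_sub, sub_mul, smul_mul_assoc, mul_smul_comm, mul_assoc, one_mul, mul_one, zero_mul, mul_zero, sub_zero, h1,h2,h3,h4,h5,h6,h7,g1,g2,g3,g4,g5,g6,g7]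
    try abel
  have e3 : (X - (0:ℤ) • (1:R))*(X - (3:ℤ) • (1:R))*(X - (2:ℤ) • (1:R))*(X - (-1:ℤ) • (1:R)) = (10:ℤ) • (1:R) + (-5:ℤ) • (a*b) + (5:ℤ) • (a*b*a*c) + (-5:ℤ) • (a*b*c*b) + (-10:ℤ) • (a*c) + (5:ℤ) • (a*c*b*a) + (-5:ℤ) • (b*a) + (5:ℤ) • (b*c) + (-5:ℤ) • (b*c*b*a) + (5:ℤ) • (c*b) := by
    rw [e2, hX]
    try simp only [zero_smul, mul_add, add_mul, mul_sub, sub_mul, smul_mul_assoc, mul_smul_comm, mul_assoc, one_mul, mul_one, zero_mul, mul_zero, sub_zero, h1,h2,h3,h4,h5,h6,h7,g1,g2,g3,g4,g5,g6,g7]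
    try abel
  have e4 : (X - (0:ℤ) • (1:R))*(X - (3:ℤ) • (1:R))*(X - (2:ℤ) • (1:R))*(X - (-1:ℤ) • (1:R))*(X - (-2:ℤ) • (1:R)) = 0 := by
    rw [e3, hX]
    try simp only [zero_smul, mul_add, add_mul, mul_sub, sub_mul, smul_mul_assoc, mul_smul_comm, mul_assoc, one_mul, mul_one, zero_mul, mul_zero, sub_zero, h1,h2,h3,h4,h5,h6,h7,g1,g2,g3,g4,g5,g6,g7]
    try abel
  exact e4

theorem relC {R : Type*} [Ring R] (a b c : R) (h1 : a*a=1) (h2 : b*b=1) (h3 : c*c=1) (h4 : c*a=a*c)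
    (h5 : b*(a*b)=a*(b*a)) (h6 : c*(b*c)=b*(c*b)) (X : R) (hX : X = (a*b*a*c) + (a*b*a*c*b*a) + (a*c*b*a) + (b*a*c*b) + (b*c) + (c*b)) :
    (X - (0:ℤ) • (1:R))*(X - (6:ℤ) • (1:R))*(X - (2:ℤ) • (1:R))*(X - (-2:ℤ) • (1:R)) = 0 := by
  have h7 : c*(b*(a*c)) = b*(c*(b*a)) := by
    rw [← h4, ← mul_assoc b, ← mul_assoc c, h6]; simp only [mul_assoc]
  have g1 : ∀ x : R, a*(a*x) = x := by
    intro x; have := congrArg (· * x) h1; simpa only [mul_assoc, one_mul] using this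
  have g2 : ∀ x : R, b*(b*x) = x := by
    intro x; have := congrArg (· * x) h2; simpa only [mul_assoc, one_mul] using this
  have g3 : ∀ x : R, c*(c*x) = x := by
    intro x; have := congrArg (· * x) h3; simpa only [mul_assoc, one_mul] using this
  have g4 : ∀ x : R, c*(a*x) = a*(c*x) := by
    intro x; have := congrArg (· * x) h4; simpa only [mul_assoc, one_mul] using this
  have g5 : ∀ x : R, b*(a*(b*x)) = a*(b*(a*x)) := by
    intro x; have := congrArg (· * x) h5; simpa only [mul_assoc, one_mul] using this
  have g6 : ∀ x : R, c*(b*(c*x)) = b*(c*(b*x)) := by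
    intro x; have := congrArg (· * x) h6; simpa only [mul_assoc, one_mul] using this
  have g7 : ∀ x : R, c*(b*(a*(c*x))) = b*(c*(b*(a*x))) := by
    intro x; have := congrArg (· * x) h7; simpa only [mul_assoc, one_mul] using this
  have e0 : (X - (0:ℤ) • (1:R)) = (a*b*a*c) + (a*b*a*c*b*a) + (a*c*b*a) + (b*a*c*b) + (b*c) + (c*b) := by
    rw [hX]
    try simp only [zero_smul, mul_add, add_mul, mul_sub, sub_mul, smul_mul_assoc, mul_smul_comm, mul_assoc, one_mul, mul_one, zero_mul, mul_zero, sub_zero, h1,h2,h3,h4,h5,h6,h7,g1,g2,g3,g4,g5,g6,g7]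
    try abel
  have e1 : (X - (0:ℤ) • (1:R))*(X - (6:ℤ) • (1:R)) = (6:ℤ) • (1:R) + (3:ℤ) • (a*b) + (-3:ℤ) • (a*b*a*c) + (-4:ℤ) • (a*b*a*c*b*a) + (3:ℤ) • (a*b*c*b) + (2:ℤ) • (a*c) + (-3:ℤ) • (a*c*b*a) + (3:ℤ) • (b*a) + (-4:ℤ) • (b*a*c*b) + (-3:ℤ) • (b*c) + (3:ℤ) • (b*c*b*a) + (-3:ℤ) • (c*b) := by
    rw [e0, hX]
    try simp only [zero_smul, mul_add, add_mul, mul_sub, sub_mul, smul_mul_assoc, mul_smul_comm, mul_assoc, one_mul, mul_one, zero_mul, mul_zero, sub_zero, h1,h2,h3,h4,h5,h6,h7,g1,g2,g3,g4,g5,g6,g7]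
    try abel
  have e2 : (X - (0:ℤ) • (1:R))*(X - (6:ℤ) • (1:R))*(X - (2:ℤ) • (1:R)) = (-32:ℤ) • (1:R) + (-8:ℤ) • (a*b) + (8:ℤ) • (a*b*a*c) + (16:ℤ) • (a*b*a*c*b*a) + (-8:ℤ) • (a*b*c*b) + (8:ℤ) • (a*c*b*a) + (-8:ℤ) • (b*a) + (16:ℤ) • (b*a*c*b) + (8:ℤ) • (b*c) + (-8:ℤ) • (b*c*b*a) + (8:ℤ) • (c*b) := by
    rw [e1, hX]
    try simp only [zero_smul, mul_add, add_mul, mul_sub, sub_mul, smul_mul_assoc, mul_smul_comm, mul_assoc, one_mul, mul_one, zero_mul, mul_zero, sub_zero, h1,h2,h3,h4,h5,h6,h7,g1,g2,g3,g4,g5,g6,g7]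
    try abel
  have e3 : (X - (0:ℤ) • (1:R))*(X - (6:ℤ) • (1:R))*(X - (2:ℤ) • (1:R))*(X - (-2:ℤ) • (1:R)) = 0 := by
    rw [e2, hX]
    try simp only [zero_smul, mul_add, add_mul, mul_sub, sub_mul, smul_mul_assoc, mul_smul_comm, mul_assoc, one_mul, mul_one, zero_mul, mul_zero, sub_zero, h1,h2,h3,h4,h5,h6,h7,g1,g2,g3,g4,g5,g6,g7]
    try abel
  exact e3

theorem stepA {R : Type*} [Ring R] (X : R) (h : (X - (2:ℤ) • (1:R))*(X - (-1:ℤ) • (1:R)) = 0) :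
    X^6 = 8*X^5 - 5*X^4 - 50*X^3 + 36*X^2 + 72*X := by
  have : X^6 - (8*X^5 - 5*X^4 - 50*X^3 + 36*X^2 + 72*X) =
     ((X - (2:ℤ) • (1:R))*(X - (-1:ℤ) • (1:R))) * ((X-3)*(X-6)*(X+2)*X) := by
    try rw [zero_smul, sub_zero]
    noncomm_ring
  rw [h, zero_mul] at this
  exact sub_eq_zero.mp this

theorem stepB {R : Type*} [Ring R] (X : R) (h : (X - (0:ℤ) • (1:R))*(X - (3:ℤ) • (1:R))*(X - (2:ℤ) • (1:R))*(X - (-1:ℤ) • (1:R))*(X - (-2:ℤ) • (1:R)) = 0) :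
    X^6 = 8*X^5 - 5*X^4 - 50*X^3 + 36*X^2 + 72*X := by
  have : X^6 - (8*X^5 - 5*X^4 - 50*X^3 + 36*X^2 + 72*X) =
     ((X - (0:ℤ) • (1:R))*(X - (3:ℤ) • (1:R))*(X - (2:ℤ) • (1:R))*(X - (-1:ℤ) • (1:R))*(X - (-2:ℤ) • (1:R))) * (X-6) := by
    try rw [zero_smul, sub_zero]
    noncomm_ring
  rw [h, zero_mul] at this
  exact sub_eq_zero.mp this

theorem stepC {R : Type*} [Ring R] (X : R) (h : (X - (0:ℤ) • (1:R))*(X - (6:ℤ) • (1:R))*(X - (2:ℤ) • (1:R))*(X - (-2:ℤ) • (1:R)) = 0) :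
    X^6 = 8*X^5 - 5*X^4 - 50*X^3 + 36*X^2 + 72*X := by
  have : X^6 - (8*X^5 - 5*X^4 - 50*X^3 + 36*X^2 + 72*X) =
     ((X - (0:ℤ) • (1:R))*(X - (6:ℤ) • (1:R))*(X - (2:ℤ) • (1:R))*(X - (-2:ℤ) • (1:R))) * ((X-3)*(X+1)) := by
    try rw [zero_smul, sub_zero]
    noncomm_ring
  rw [h, zero_mul] at this
  exact sub_eq_zero.mp this

theorem stepN {R : Type*} [Ring R] (X : R) (h : X^6 = 8*X^5 - 5*X^4 - 50*X^3 + 36*X^2 + 72*X) (n : ℕ) :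
    X^(n+6) = 8*X^(n+5) - 5*X^(n+4) - 50*X^(n+3) + 36*X^(n+2) + 72*X^(n+1) := by
  have := congrArg (· * X^n) h
  simp only [add_mul, sub_mul, mul_assoc, ← pow_add, ← pow_succ'] at this
  simpa only [add_comm] using this

theorem commL (x y z : Equiv.Perm (Fin 4)) (h : x * y = z) :
    (single x 1 * single y 1 : MonoidAlgebra ℤ (Equiv.Perm (Fin 4))) = single z 1 := by
  rw [single_mul_single, h, one_mul]

theorem comm23 : Commute L2 L3 := by
  unfold Commute SemiconjBy L2 L3
  simp only [mul_add, add_mul, single_mul_single, one_mul]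
  rw [show (Equiv.swap 0 1 * Equiv.swap 0 2 : Equiv.Perm (Fin 4)) = Equiv.swap 1 2 * Equiv.swap 0 1 by decide,
    show (Equiv.swap 0 1 * Equiv.swap 1 2 : Equiv.Perm (Fin 4)) = Equiv.swap 0 2 * Equiv.swap 0 1 by decide]
  abel

theorem comm24 : Commute L2 L4 := by
  unfold Commute SemiconjBy L2 L4
  simp only [mul_add, add_mul, single_mul_single, one_mul]
  rw [show (Equiv.swap 0 1 * Equiv.swap 0 3 : Equiv.Perm (Fin 4)) = Equiv.swap 1 3 * Equiv.swap 0 1 by decide,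
    show (Equiv.swap 0 1 * Equiv.swap 1 3 : Equiv.Perm (Fin 4)) = Equiv.swap 0 3 * Equiv.swap 0 1 by decide,
    show (Equiv.swap 0 1 * Equiv.swap 2 3 : Equiv.Perm (Fin 4)) = Equiv.swap 2 3 * Equiv.swap 0 1 by decide]
  abel

theorem comm34 : Commute L3 L4 := by
  unfold Commute SemiconjBy L3 L4
  simp only [mul_add, add_mul, single_mul_single, one_mul]
  rw [show (Equiv.swap 0 2 * Equiv.swap 0 3 : Equiv.Perm (Fin 4)) = Equiv.swap 2 3 * Equiv.swap 0 2 by decide,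
    show (Equiv.swap 0 2 * Equiv.swap 1 3 : Equiv.Perm (Fin 4)) = Equiv.swap 1 3 * Equiv.swap 0 2 by decide,
    show (Equiv.swap 0 2 * Equiv.swap 2 3 : Equiv.Perm (Fin 4)) = Equiv.swap 0 3 * Equiv.swap 0 2 by decide,
    show (Equiv.swap 1 2 * Equiv.swap 0 3 : Equiv.Perm (Fin 4)) = Equiv.swap 0 3 * Equiv.swap 1 2 by decide,
    show (Equiv.swap 1 2 * Equiv.swap 1 3 : Equiv.Perm (Fin 4)) = Equiv.swap 2 3 * Equiv.swap 1 2 by decide,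
    show (Equiv.swap 1 2 * Equiv.swap 2 3 : Equiv.Perm (Fin 4)) = Equiv.swap 1 3 * Equiv.swap 1 2 by decide]
  abel

theorem polA : (L2*L3)^6 = 8*(L2*L3)^5 - 5*(L2*L3)^4 - 50*(L2*L3)^3 + 36*(L2*L3)^2 + 72*(L2*L3) := by
  apply stepA
  apply relA (single (Equiv.swap 0 1 : Equiv.Perm (Fin 4)) (1:ℤ)) (single (Equiv.swap 1 2 : Equiv.Perm (Fin 4)) (1:ℤ)) (single (Equiv.swap 2 3 : Equiv.Perm (Fin 4)) (1:ℤ))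
  iterate 6 (simp only [single_mul_single, one_mul, one_def]; congr 1; decide)
  unfold L2 L3
  simp only [mul_add, add_mul, single_mul_single, one_mul]
  rw [show (Equiv.swap 0 1 * Equiv.swap 0 2 : Equiv.Perm (Fin 4)) = Equiv.swap 1 2 * Equiv.swap 0 1 by decide]
  try abel

theorem polB : (L2*L4)^6 = 8*(L2*L4)^5 - 5*(L2*L4)^4 - 50*(L2*L4)^3 + 36*(L2*L4)^2 + 72*(L2*L4) := by
  apply stepB
  apply relB (single (Equiv.swap 0 1 : Equiv.Perm (Fin 4)) (1:ℤ)) (single (Equiv.swap 1 2 : Equiv.Perm (Fin 4)) (1:ℤ)) (single (Equiv.swap 2 3 : Equiv.Perm (Fin 4)) (1:ℤ))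
  iterate 6 (simp only [single_mul_single, one_mul, one_def]; congr 1; decide)
  unfold L2 L4
  simp only [mul_add, add_mul, single_mul_single, one_mul]
  rw [show (Equiv.swap 0 1 * Equiv.swap 0 3 : Equiv.Perm (Fin 4)) = Equiv.swap 1 2 * Equiv.swap 2 3 * Equiv.swap 1 2 * Equiv.swap 0 1 by decide]
  rw [show (Equiv.swap 0 1 * Equiv.swap 1 3 : Equiv.Perm (Fin 4)) = Equiv.swap 0 1 * Equiv.swap 1 2 * Equiv.swap 2 3 * Equiv.swap 1 2 by decide]
  try abel

theorem polC : (L3*L4)^6 = 8*(L3*L4)^5 - 5*(L3*L4)^4 - 50*(L3*L4)^3 + 36*(L3*L4)^2 + 72*(L3*L4) := by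
  apply stepC
  apply relC (single (Equiv.swap 0 1 : Equiv.Perm (Fin 4)) (1:ℤ)) (single (Equiv.swap 1 2 : Equiv.Perm (Fin 4)) (1:ℤ)) (single (Equiv.swap 2 3 : Equiv.Perm (Fin 4)) (1:ℤ))
  iterate 6 (simp only [single_mul_single, one_mul, one_def]; congr 1; decide)
  unfold L3 L4
  simp only [mul_add, add_mul, single_mul_single, one_mul]
  rw [show (Equiv.swap 0 2 * Equiv.swap 0 3 : Equiv.Perm (Fin 4)) = Equiv.swap 0 1 * Equiv.swap 2 3 * Equiv.swap 1 2 * Equiv.swap 0 1 by decide]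
  rw [show (Equiv.swap 0 2 * Equiv.swap 1 3 : Equiv.Perm (Fin 4)) = Equiv.swap 1 2 * Equiv.swap 0 1 * Equiv.swap 2 3 * Equiv.swap 1 2 by decide]
  rw [show (Equiv.swap 0 2 * Equiv.swap 2 3 : Equiv.Perm (Fin 4)) = Equiv.swap 0 1 * Equiv.swap 1 2 * Equiv.swap 0 1 * Equiv.swap 2 3 by decide]
  rw [show (Equiv.swap 1 2 * Equiv.swap 0 3 : Equiv.Perm (Fin 4)) = Equiv.swap 0 1 * Equiv.swap 1 2 * Equiv.swap 0 1 * Equiv.swap 2 3 * Equiv.swap 1 2 * Equiv.swap 0 1 by decide]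
  rw [show (Equiv.swap 1 2 * Equiv.swap 1 3 : Equiv.Perm (Fin 4)) = Equiv.swap 2 3 * Equiv.swap 1 2 by decide]
  try abel

theorem mII_eq (i : ℕ) : mII i = (L2*L3)^i + (L2*L4)^i + (L3*L4)^i := by
  rw [comm23.mul_pow, comm24.mul_pow, comm34.mul_pow]; rfl

theorem mII_recursion (i : ℕ) (hi : 6 ≤ i) :
    mII i = 8 * mII (i - 1) - 5 * mII (i - 2) - 50 * mII (i - 3)
      + 36 * mII (i - 4) + 72 * mII (i - 5) := by
  obtain ⟨n, rfl⟩ := Nat.exists_eq_add_of_le' hi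
  rw [show n + 6 - 1 = n + 5 by omega, show n + 6 - 2 = n + 4 by omega,
    show n + 6 - 3 = n + 3 by omega, show n + 6 - 4 = n + 2 by omega,
    show n + 6 - 5 = n + 1 by omega]
  simp only [mII_eq]
  rw [stepN _ polA n, stepN _ polB n, stepN _ polC n]
  simp only [mul_add]
  abel
end

section
/- In ℤS₄, for every integer i ≥ 5, m_{i,i,i} = 40·m_{i-2,i-2,i-2} − 144·m_{i-4,i-4,i-4}, where m_{i,i,i} := L₂^iL₃^iL₄^i. -/
open MonoidAlgebra

/-- `m_{i,i,i} = m_{(i,i,i)}(L₁,L₂,L₃,L₄)` (recall `L₁ = 0`). -/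
noncomputable def mIII (i : ℕ) : MonoidAlgebra ℤ (Equiv.Perm (Fin 4)) := L2 ^ i * L3 ^ i * L4 ^ i


namespace Aux

abbrev G := Equiv.Perm (Fin 4)

noncomputable def F (f : G → ℤ) : MonoidAlgebra ℤ G := ∑ w, single w (f w)

def conv (f g : G → ℤ) : G → ℤ := fun w => ∑ a, f a * g (a⁻¹ * w)

theorem F_mul (f g : G → ℤ) : F f * F g = F (conv f g) := by
  unfold F conv
  rw [Finset.sum_mul]
  simp_rw [Finset.mul_sum, single_mul_single]
  have h : ∀ w : G, single w (∑ a, f a * g (a⁻¹ * w))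
      = ∑ a, (single w (f a * g (a⁻¹ * w)) : MonoidAlgebra ℤ G) := fun w =>
    map_sum (singleAddHom w) _ _
  simp_rw [h]
  rw [Finset.sum_comm (f := fun w a => (single w (f a * g (a⁻¹ * w)) : MonoidAlgebra ℤ G))]
  refine Finset.sum_congr rfl fun a _ => ?_
  refine Fintype.sum_equiv (Equiv.mulLeft a) _ _ fun b => ?_
  simp

def d (x : G) : G → ℤ := fun w => if w = x then 1 else 0

theorem F_d (x : G) : F (d x) = single x 1 := by
  unfold F d
  rw [Finset.sum_eq_single x]
  · simp
  · intro b _ hb; simp [hb]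
  · simp

theorem F_add (f g : G → ℤ) : F f + F g = F (f + g) := by
  simp [F, Finset.sum_add_distrib]

def f2 : G → ℤ := d (Equiv.swap 0 1)
def f3 : G → ℤ := d (Equiv.swap 0 2) + d (Equiv.swap 1 2)
def f4 : G → ℤ := d (Equiv.swap 0 3) + d (Equiv.swap 1 3) + d (Equiv.swap 2 3)
/-- sum of the 4-cycles -/
def fP : G → ℤ := fun w => if w * w ≠ 1 ∧ w * w * w ≠ 1 then 1 else 0
def fP2 : G → ℤ := fun w => if w = 1 then 6 else if w * w * w = 1 then 3 else
  if w * w = 1 ∧ ∀ x, w x ≠ x then 2 else 0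
def fP3 : G → ℤ := fun w => if w * w = 1 then (if w = 1 ∨ ∀ x, w x ≠ x then 0 else 16) else
  if w * w * w = 1 then 0 else 20

theorem e2 : L2 = F f2 := by simp [L2, f2, F_d]
theorem e3 : L3 = F f3 := by simp [L3, f3, F_d, ← F_add]
theorem e4 : L4 = F f4 := by simp [L4, f4, F_d, ← F_add]

set_option maxRecDepth 100000
theorem c23 : conv f2 f3 = conv f3 f2 := funext (by decide +kernel)
theorem c24 : conv f2 f4 = conv f4 f2 := funext (by decide +kernel)
theorem c34 : conv f3 f4 = conv f4 f3 := funext (by decide +kernel)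
theorem cP : conv (conv f2 f3) f4 = fP := funext (by decide +kernel)
theorem cP2 : conv fP fP = fP2 := funext (by decide +kernel)
theorem cP3 : conv fP2 fP = fP3 := funext (by decide +kernel)
theorem cP5 : conv fP3 fP2 = fun w => 40 * fP3 w - 144 * fP w := funext (by decide +kernel)


theorem F_P : L2 * L3 * L4 = F fP := by rw [e2, e3, e4, F_mul, F_mul, cP]

theorem m_eq (i : ℕ) : mIII i = F fP ^ i := by
  have h23 : Commute L2 L3 := by
    rw [Commute, SemiconjBy, e2, e3, F_mul, F_mul, c23]
  have h24 : Commute L2 L4 := by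
    rw [Commute, SemiconjBy, e2, e4, F_mul, F_mul, c24]
  have h34 : Commute L3 L4 := by
    rw [Commute, SemiconjBy, e3, e4, F_mul, F_mul, c34]
  rw [mIII, ← F_P, (h24.mul_left h34).mul_pow, h23.mul_pow]

theorem F_lin (f g : G → ℤ) : F (fun w => 40 * f w - 144 * g w) = 40 * F f - 144 * F g := by
  have h : (fun w => 40 * f w - 144 * g w) = (40 : ℤ) • f - (144 : ℤ) • g := by
    ext w; simp
  have h1 : ∀ (c : ℤ) (k : G → ℤ), F (c • k) = c • F k := by
    intro c k; simp [F, Finset.smul_sum]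
  have h2 : F ((40 : ℤ) • f - (144 : ℤ) • g) + F ((144 : ℤ) • g) = F ((40 : ℤ) • f) := by
    rw [F_add, sub_add_cancel]
  rw [h, eq_sub_of_add_eq h2, h1, h1, zsmul_eq_mul, zsmul_eq_mul]
  norm_num

theorem P5 : F fP ^ 5 = 40 * F fP ^ 3 - 144 * F fP := by
  have p2 : F fP ^ 2 = F fP2 := by rw [pow_two, F_mul, cP2]
  have p3 : F fP ^ 3 = F fP3 := by rw [pow_succ, p2, F_mul, cP3]
  rw [show 5 = 3 + 2 from rfl, pow_add, p2, p3, F_mul, cP5, F_lin]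

end Aux

theorem mIII_recursion (i : ℕ) (hi : 5 ≤ i) :
    mIII i = 40 * mIII (i - 2) - 144 * mIII (i - 4) := by
  obtain ⟨k, rfl⟩ := Nat.exists_eq_add_of_le hi
  rw [show 5 + k - 2 = 3 + k by omega, show 5 + k - 4 = 1 + k by omega]
  simp only [Aux.m_eq]
  rw [pow_add, Aux.P5, pow_add, pow_add, pow_one, sub_mul, mul_assoc, mul_assoc]
end

section
/- In ℤS₄, for every integer i ≥ 1 the coefficients of m_i := L₂^i + L₃^i + L₄^i satisfy: 24·⟨1,m_i⟩ = (1+(−1)^i)(3^i + 10·2^i + 23); 24·⟨s₁,m_i⟩ = (1−(−1)^i)(3^i + 4·2^i + 1); 24·⟨s₁₂,m_i⟩ = (1+(−1)^i)(3^i + 2^i − 1); 24·⟨s₁₃,m_i⟩ = (1+(−1)^i)(3^i − 2·2^i − 1); 24·⟨s₁₂₃,m_i⟩ = (1−(−1)^i)(3^i − 2·2^i + 1). -/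
open MonoidAlgebra hiding coeff

lemma coeff_one' (w : Equiv.Perm (Fin 4)) :
    coeff 1 w = if 1 = w then (1 : ℤ) else 0 := by
  simp [coeff, MonoidAlgebra.one_def, Finsupp.single_apply]

lemma coeff_add' (a b : MonoidAlgebra ℤ (Equiv.Perm (Fin 4))) (w : Equiv.Perm (Fin 4)) :
    coeff (a + b) w = coeff a w + coeff b w := by
  simp [coeff]

def cls4 (w : Equiv.Perm (Fin 4)) : Fin 7 :=
  if w 3 = 3 then
    (if w = 1 then 0 else if w * w = 1 then 1 else 2)
  else if w * w = 1 then (if w 0 = 0 ∨ w 1 = 1 ∨ w 2 = 2 then 3 else 5)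
  else if w * w * w = 1 then 4 else 6

def nb4 : Fin 7 → Multiset (Fin 7) := ![{3, 3, 3}, {4, 4, 5}, {6, 6, 6}, {0, 4, 4}, {1, 3, 6}, {1, 6, 6}, {2, 4, 5}]

def F4 (i : ℕ) : Fin 7 → ℤ :=
  ![(1 + (-1 : ℤ) ^ i) * (1 * 3 ^ i + 6 * 2 ^ i + 3),
    (1 - (-1 : ℤ) ^ i) * (1 * 3 ^ i + 0 * 2 ^ i + -3),
    (1 + (-1 : ℤ) ^ i) * (1 * 3 ^ i + -3 * 2 ^ i + 3),
    (1 - (-1 : ℤ) ^ i) * (1 * 3 ^ i + 4 * 2 ^ i + 1),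
    (1 + (-1 : ℤ) ^ i) * (1 * 3 ^ i + 1 * 2 ^ i + -1),
    (1 + (-1 : ℤ) ^ i) * (1 * 3 ^ i + -2 * 2 ^ i + -1),
    (1 - (-1 : ℤ) ^ i) * (1 * 3 ^ i + -2 * 2 ^ i + 1)]

lemma nb4_spec : ∀ w : Equiv.Perm (Fin 4), ({cls4 (Equiv.swap 0 3 * w), cls4 (Equiv.swap 1 3 * w), cls4 (Equiv.swap 2 3 * w)} : Multiset (Fin 7)) = nb4 (cls4 w) := by
  decide +kernel

lemma base4 : ∀ w : Equiv.Perm (Fin 4),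
    24 * ((if 1 = Equiv.swap 0 3 * w then (1 : ℤ) else 0) + (if 1 = Equiv.swap 1 3 * w then (1 : ℤ) else 0) + (if 1 = Equiv.swap 2 3 * w then (1 : ℤ) else 0)) = F4 1 (cls4 w) := by
  decide +kernel

lemma step4 (i : ℕ) : ∀ k : Fin 7, ((nb4 k).map (F4 i)).sum = F4 (i + 1) k := by
  intro k
  fin_cases k <;> simp [nb4, F4] <;> ring

lemma mul4_s5 (h : MonoidAlgebra ℤ (Equiv.Perm (Fin 4))) (w : Equiv.Perm (Fin 4)) :
    coeff (L4 * h) w = coeff h (Equiv.swap 0 3 * w) + coeff h (Equiv.swap 1 3 * w) + coeff h (Equiv.swap 2 3 * w) := by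
  simp [coeff, L4, add_mul]

lemma main4 (i : ℕ) : ∀ w, 24 * coeff (L4 ^ (i + 1)) w = F4 (i + 1) (cls4 w) := by
  induction i with
  | zero =>
    intro w
    rw [pow_succ', mul4_s5, ← base4]
    simp only [pow_zero, coeff_one']
  | succ i ih =>
    intro w
    rw [pow_succ', mul4_s5, ← step4, ← nb4_spec]
    simp only [mul_add, ih, Multiset.insert_eq_cons, Multiset.map_cons, Multiset.sum_cons,
      Multiset.map_singleton, Multiset.sum_singleton, add_assoc]

def cls3 (w : Equiv.Perm (Fin 4)) : Fin 5 :=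
  if w 3 = 3 then
    (if w 2 = 2 then (if w = 1 then 0 else 1) else if w * w = 1 then 2 else 3)
  else 4

def nb3 : Fin 5 → Multiset (Fin 5) := ![{2, 2}, {3, 3}, {0, 3}, {1, 2}, {4, 4}]

def F3 (i : ℕ) : Fin 5 → ℤ :=
  ![(1 + (-1 : ℤ) ^ i) * (0 * 3 ^ i + 4 * 2 ^ i + 8),
    (1 - (-1 : ℤ) ^ i) * (0 * 3 ^ i + 4 * 2 ^ i + -8),
    (1 - (-1 : ℤ) ^ i) * (0 * 3 ^ i + 4 * 2 ^ i + 4),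
    (1 + (-1 : ℤ) ^ i) * (0 * 3 ^ i + 4 * 2 ^ i + -4),
    (1 - (-1 : ℤ) ^ i) * (0 * 3 ^ i + 0 * 2 ^ i + 0)]

lemma nb3_spec : ∀ w : Equiv.Perm (Fin 4), ({cls3 (Equiv.swap 0 2 * w), cls3 (Equiv.swap 1 2 * w)} : Multiset (Fin 5)) = nb3 (cls3 w) := by
  decide +kernel

lemma base3 : ∀ w : Equiv.Perm (Fin 4),
    24 * ((if 1 = Equiv.swap 0 2 * w then (1 : ℤ) else 0) + (if 1 = Equiv.swap 1 2 * w then (1 : ℤ) else 0)) = F3 1 (cls3 w) := by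
  decide +kernel

lemma step3 (i : ℕ) : ∀ k : Fin 5, ((nb3 k).map (F3 i)).sum = F3 (i + 1) k := by
  intro k
  fin_cases k <;> simp [nb3, F3] <;> ring

lemma mul3_s5 (h : MonoidAlgebra ℤ (Equiv.Perm (Fin 4))) (w : Equiv.Perm (Fin 4)) :
    coeff (L3 * h) w = coeff h (Equiv.swap 0 2 * w) + coeff h (Equiv.swap 1 2 * w) := by
  simp [coeff, L3, add_mul]

lemma main3 (i : ℕ) : ∀ w, 24 * coeff (L3 ^ (i + 1)) w = F3 (i + 1) (cls3 w) := by
  induction i with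
  | zero =>
    intro w
    rw [pow_succ', mul3_s5, ← base3]
    simp only [pow_zero, coeff_one']
  | succ i ih =>
    intro w
    rw [pow_succ', mul3_s5, ← step3, ← nb3_spec]
    simp only [mul_add, ih, Multiset.insert_eq_cons, Multiset.map_cons, Multiset.sum_cons,
      Multiset.map_singleton, Multiset.sum_singleton, add_assoc]

def cls2 (w : Equiv.Perm (Fin 4)) : Fin 3 :=
  if w = 1 then 0 else if w = Equiv.swap 0 1 then 1 else 2

def nb2 : Fin 3 → Multiset (Fin 3) := ![{1}, {0}, {2}]

def F2 (i : ℕ) : Fin 3 → ℤ :=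
  ![(1 + (-1 : ℤ) ^ i) * (0 * 3 ^ i + 0 * 2 ^ i + 12),
    (1 - (-1 : ℤ) ^ i) * (0 * 3 ^ i + 0 * 2 ^ i + 12),
    (1 - (-1 : ℤ) ^ i) * (0 * 3 ^ i + 0 * 2 ^ i + 0)]

lemma nb2_spec : ∀ w : Equiv.Perm (Fin 4), ({cls2 (Equiv.swap 0 1 * w)} : Multiset (Fin 3)) = nb2 (cls2 w) := by
  decide +kernel

lemma base2 : ∀ w : Equiv.Perm (Fin 4),
    24 * ((if 1 = Equiv.swap 0 1 * w then (1 : ℤ) else 0)) = F2 1 (cls2 w) := by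
  decide +kernel

lemma step2 (i : ℕ) : ∀ k : Fin 3, ((nb2 k).map (F2 i)).sum = F2 (i + 1) k := by
  intro k
  fin_cases k <;> simp [nb2, F2] <;> ring

lemma mul2 (h : MonoidAlgebra ℤ (Equiv.Perm (Fin 4))) (w : Equiv.Perm (Fin 4)) :
    coeff (L2 * h) w = coeff h (Equiv.swap 0 1 * w) := by
  simp [coeff, L2, add_mul]

lemma main2 (i : ℕ) : ∀ w, 24 * coeff (L2 ^ (i + 1)) w = F2 (i + 1) (cls2 w) := by
  induction i with
  | zero =>
    intro w
    rw [pow_succ', mul2, ← base2]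
    simp only [pow_zero, coeff_one']
  | succ i ih =>
    intro w
    rw [pow_succ', mul2, ← step2, ← nb2_spec]
    simp only [mul_add, ih, Multiset.insert_eq_cons, Multiset.map_cons, Multiset.sum_cons,
      Multiset.map_singleton, Multiset.sum_singleton, add_assoc]

theorem closed_forms_mI (i : ℕ) (hi : 1 ≤ i) :
    24 * coeff (mI i) 1 = (1 + (-1 : ℤ) ^ i) * (3 ^ i + 10 * 2 ^ i + 23) ∧
    24 * coeff (mI i) s1 = (1 - (-1 : ℤ) ^ i) * (3 ^ i + 4 * 2 ^ i + 1) ∧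
    24 * coeff (mI i) s12 = (1 + (-1 : ℤ) ^ i) * (3 ^ i + 2 ^ i - 1) ∧
    24 * coeff (mI i) s13 = (1 + (-1 : ℤ) ^ i) * (3 ^ i - 2 * 2 ^ i - 1) ∧
    24 * coeff (mI i) s123 = (1 - (-1 : ℤ) ^ i) * (3 ^ i - 2 * 2 ^ i + 1) := by
  obtain ⟨i, rfl⟩ : ∃ j, i = j + 1 := ⟨i - 1, by omega⟩
  refine ⟨?_, ?_, ?_, ?_, ?_⟩
  · rw [mI, coeff_add', coeff_add', mul_add, mul_add, main2, main3, main4,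
      show cls2 1 = 0 by decide +kernel, show cls3 1 = 0 by decide +kernel,
      show cls4 1 = 0 by decide +kernel]
    simp [F2, F3, F4, -mul_eq_mul_left_iff]
    ring
  · rw [mI, coeff_add', coeff_add', mul_add, mul_add, main2, main3, main4,
      show cls2 s1 = 1 by decide +kernel, show cls3 s1 = 1 by decide +kernel,
      show cls4 s1 = 1 by decide +kernel]
    simp [F2, F3, F4, -mul_eq_mul_left_iff]
    ring
  · rw [mI, coeff_add', coeff_add', mul_add, mul_add, main2, main3, main4,
      show cls2 s12 = 2 by decide +kernel, show cls3 s12 = 3 by decide +kernel,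
      show cls4 s12 = 2 by decide +kernel]
    simp [F2, F3, F4, -mul_eq_mul_left_iff]
    ring
  · rw [mI, coeff_add', coeff_add', mul_add, mul_add, main2, main3, main4,
      show cls2 s13 = 2 by decide +kernel, show cls3 s13 = 4 by decide +kernel,
      show cls4 s13 = 5 by decide +kernel]
    simp [F2, F3, F4, -mul_eq_mul_left_iff]
    ring
  · rw [mI, coeff_add', coeff_add', mul_add, mul_add, main2, main3, main4,
      show cls2 s123 = 2 by decide +kernel, show cls3 s123 = 4 by decide +kernel,
      show cls4 s123 = 6 by decide +kernel]
    simp [F2, F3, F4, -mul_eq_mul_left_iff]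
    ring
end

section
/- In ℤS₄, for all integers i, j ≥ 1 with i ≠ j, the coefficients of m_{i,i,j} := L₂^iL₃^iL₄^j + L₂^iL₄^iL₃^j + L₃^iL₄^iL₂^j satisfy: 24·⟨1,m_{i,i,j}⟩ = (1+(−1)^j)(6^i + 2^i·3^j + 2^j·3^i + 9·(−1)^i(2^i+2^j) + 9·2^i); 24·⟨s₁,m_{i,i,j}⟩ = (1−(−1)^j)(6^i + 2^i·3^j + 2^j·3^i + 3·(−1)^i(2^i+2^j) − 3·2^i); 24·⟨s₁₂,m_{i,i,j}⟩ = (1+(−1)^j)(6^i + 2^i·3^j + 2^j·3^i); 24·⟨s₁₃,m_{i,i,j}⟩ = (1+(−1)^j)(6^i + 2^i·3^j + 2^j·3^i − 3·(−1)^i(2^i+2^j) − 3·2^i); 24·⟨s₁₂₃,m_{i,i,j}⟩ = (1−(−1)^j)(6^i + 2^i·3^j + 2^j·3^i − 3·(−1)^i(2^i+2^j) + 3·2^i). -/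
open MonoidAlgebra hiding coeff

/-- `m_{i,i,j} = m_{(i,i,j)}(L₁,L₂,L₃,L₄)` for `i ≠ j` (recall `L₁ = 0`). -/
noncomputable def mIIJ (i j : ℕ) : MonoidAlgebra ℤ (Equiv.Perm (Fin 4)) :=
  L2 ^ i * L3 ^ i * L4 ^ j + L2 ^ i * L4 ^ i * L3 ^ j + L3 ^ i * L4 ^ i * L2 ^ j


def bas (w : Equiv.Perm (Fin 4)) : ℤ := if w = 1 then 1 else 0
def a2 (c : ℤ) (f : Equiv.Perm (Fin 4) → ℤ) (w : Equiv.Perm (Fin 4)) : ℤ :=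
  f (Equiv.swap 0 1 * w) + c * f w
def a3 (c : ℤ) (f : Equiv.Perm (Fin 4) → ℤ) (w : Equiv.Perm (Fin 4)) : ℤ :=
  f (Equiv.swap 0 2 * w) + f (Equiv.swap 1 2 * w) + c * f w
def a4 (c : ℤ) (f : Equiv.Perm (Fin 4) → ℤ) (w : Equiv.Perm (Fin 4)) : ℤ :=
  f (Equiv.swap 0 3 * w) + f (Equiv.swap 1 3 * w) + f (Equiv.swap 2 3 * w) + c * f w

abbrev AA := MonoidAlgebra ℤ (Equiv.Perm (Fin 4))

lemma coeff_add'_s9 (g h : AA) (w) : coeff (g + h) w = coeff g w + coeff h w := by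
  simp [coeff]
lemma coeff_smul' (c : ℤ) (h : AA) (w) : coeff (c • h) w = c * coeff h w := by
  simp [coeff, -zsmul_eq_mul]
lemma coeff_one'_s9 : coeff (1 : AA) = bas := by
  funext w
  simp [coeff, bas, MonoidAlgebra.one_def, Finsupp.single_apply, eq_comm]
lemma coeff_swap (a b : Fin 4) (h : AA) (w) :
    coeff (single (Equiv.swap a b) 1 * h) w = coeff h (Equiv.swap a b * w) := by
  simp [coeff, MonoidAlgebra.coeff_single_mul_apply]
lemma coeff_ext (g h : AA) (H : ∀ w, coeff g w = coeff h w) : g = h := by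
  ext w; exact H w

noncomputable def b2 (c : ℤ) (h : AA) : AA := L2 * h + c • h
noncomputable def b3 (c : ℤ) (h : AA) : AA := L3 * h + c • h
noncomputable def b4 (c : ℤ) (h : AA) : AA := L4 * h + c • h

lemma coeff_b2 (c : ℤ) (h : AA) : coeff (b2 c h) = a2 c (coeff h) := by
  funext w; simp only [b2, L2, a2, coeff_add'_s9, coeff_smul', coeff_swap]
lemma coeff_b3 (c : ℤ) (h : AA) : coeff (b3 c h) = a3 c (coeff h) := by
  funext w; simp only [b3, L3, a3, add_mul, coeff_add'_s9, coeff_smul', coeff_swap]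
lemma coeff_b4 (c : ℤ) (h : AA) : coeff (b4 c h) = a4 c (coeff h) := by
  funext w; simp only [b4, L4, a4, add_mul, coeff_add'_s9, coeff_smul', coeff_swap]

lemma eig {L e : AA} {c : ℤ} (h : L * e + (-c) • e = 0) : L * e = c • e := by
  rw [neg_smul] at h
  exact add_neg_eq_zero.mp h

lemma pow_eig {L e : AA} {c : ℤ} (h : L * e = c • e) (n : ℕ) : L ^ n * e = c ^ n • e := by
  induction n with
  | zero => simp
  | succ k ih => rw [pow_succ, mul_assoc, h, mul_smul_comm, ih, smul_smul, pow_succ, mul_comm]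

lemma m_eig {e : AA} {x y z : ℤ} (h2 : L2 * e = x • e) (h3 : L3 * e = y • e)
    (h4 : L4 * e = z • e) (i j : ℕ) : mIIJ i j * e =
      (x ^ i * y ^ i * z ^ j + x ^ i * z ^ i * y ^ j + y ^ i * z ^ i * x ^ j) • e := by
  simp only [mIIJ, add_mul, mul_assoc, pow_eig h2, pow_eig h3, pow_eig h4, mul_smul_comm,
    smul_smul, add_smul]
  congr 1
  · congr 1 <;> congr 1 <;> ring
  · congr 1; ring

noncomputable def mk (f : Equiv.Perm (Fin 4) → ℤ) : AA := ∑ w, single w (f w)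
lemma coeff_mk (f : Equiv.Perm (Fin 4) → ℤ) : coeff (mk f) = f := by
  funext v
  simp [mk, coeff, Finsupp.single_apply]
/-- lexicographic rank of a permutation -/
def rk (w : Equiv.Perm (Fin 4)) : ℕ :=
  6 * (w 0).val + 2 * ((w 1).val - cond (Nat.ble (w 1).val (w 0).val) 0 1)
    + cond (Nat.ble (w 2).val (w 3).val) 0 1

lemma coeff_zero' (w) : coeff (0 : AA) w = 0 := by simp [coeff]

lemma m_fun {e : AA} {f : Equiv.Perm (Fin 4) → ℤ} (he : coeff e = f) (x y z : ℤ)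
    (h2 : ∀ w, a2 (-x) f w = 0) (h3 : ∀ w, a3 (-y) f w = 0) (h4 : ∀ w, a4 (-z) f w = 0)
    (i j : ℕ) : mIIJ i j * e =
      (x ^ i * y ^ i * z ^ j + x ^ i * z ^ i * y ^ j + y ^ i * z ^ i * x ^ j) • e := by
  subst he
  refine m_eig (eig (coeff_ext _ _ fun w => ?_)) (eig (coeff_ext _ _ fun w => ?_))
    (eig (coeff_ext _ _ fun w => ?_)) i j
  · rw [coeff_zero', ← h2 w, ← coeff_b2]; rfl
  · rw [coeff_zero', ← h3 w, ← coeff_b3]; rfl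
  · rw [coeff_zero', ← h4 w, ← coeff_b4]; rfl

def f0 (w : Equiv.Perm (Fin 4)) : ℤ :=
  [1, 1, 1, 1, 1, 1, 1, 1, 1, 1, 1, 1, 1, 1, 1, 1, 1, 1, 1, 1, 1, 1, 1, 1].getD (rk w) 0
noncomputable def e0 : AA := mk f0
lemma ef0 : coeff e0 = f0 := coeff_mk _
lemma me0 (i j : ℕ) : mIIJ i j * e0 = ((1) ^ i * (2) ^ i * (3) ^ j + (1) ^ i * (3) ^ i * (2) ^ j +
    (2) ^ i * (3) ^ i * (1) ^ j : ℤ) • e0 := m_fun ef0 (1) (2) (3)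
  (by decide +kernel) (by decide +kernel) (by decide +kernel) i j

def f1 (w : Equiv.Perm (Fin 4)) : ℤ :=
  [-3, 1, -3, 1, 1, 1, -3, 1, -3, 1, 1, 1, -3, 1, -3, 1, 1, 1, 1, 1, 1, 1, 1, 1].getD (rk w) 0
noncomputable def e1 : AA := mk f1
lemma ef1 : coeff e1 = f1 := coeff_mk _
lemma me1 (i j : ℕ) : mIIJ i j * e1 = ((1) ^ i * (2) ^ i * (-1) ^ j + (1) ^ i * (-1) ^ i * (2) ^ j +
    (2) ^ i * (-1) ^ i * (1) ^ j : ℤ) • e1 := m_fun ef1 (1) (2) (-1)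
  (by decide +kernel) (by decide +kernel) (by decide +kernel) i j

def f2 (w : Equiv.Perm (Fin 4)) : ℤ :=
  [-6, -2, 3, 1, 1, -5, -6, -2, 3, 1, 1, -5, 3, 1, 3, 1, 4, 4, 1, -5, 1, -5, 4, 4].getD (rk w) 0
noncomputable def e2 : AA := mk f2
lemma ef2 : coeff e2 = f2 := coeff_mk _
lemma me2 (i j : ℕ) : mIIJ i j * e2 = ((1) ^ i * (-1) ^ i * (2) ^ j + (1) ^ i * (2) ^ i * (-1) ^ j +
    (-1) ^ i * (2) ^ i * (1) ^ j : ℤ) • e2 := m_fun ef2 (1) (-1) (2)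
  (by decide +kernel) (by decide +kernel) (by decide +kernel) i j

def f3 (w : Equiv.Perm (Fin 4)) : ℤ :=
  [2, 2, -1, -1, -1, -1, 2, 2, -1, -1, -1, -1, -1, -1, -1, -1, 2, 2, -1, -1, -1, -1, 2, 2].getD (rk w) 0
noncomputable def e3 : AA := mk f3
lemma ef3 : coeff e3 = f3 := coeff_mk _
lemma me3 (i j : ℕ) : mIIJ i j * e3 = ((1) ^ i * (-1) ^ i * (0) ^ j + (1) ^ i * (0) ^ i * (-1) ^ j +
    (-1) ^ i * (0) ^ i * (1) ^ j : ℤ) • e3 := m_fun ef3 (1) (-1) (0)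
  (by decide +kernel) (by decide +kernel) (by decide +kernel) i j

def f4 (w : Equiv.Perm (Fin 4)) : ℤ :=
  [-6, 6, 3, -3, -3, 3, -6, 6, 3, -3, -3, 3, 3, -3, 3, -3, 0, 0, -3, 3, -3, 3, 0, 0].getD (rk w) 0
noncomputable def e4 : AA := mk f4
lemma ef4 : coeff e4 = f4 := coeff_mk _
lemma me4 (i j : ℕ) : mIIJ i j * e4 = ((1) ^ i * (-1) ^ i * (-2) ^ j + (1) ^ i * (-2) ^ i * (-1) ^ j +
    (-1) ^ i * (-2) ^ i * (1) ^ j : ℤ) • e4 := m_fun ef4 (1) (-1) (-2)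
  (by decide +kernel) (by decide +kernel) (by decide +kernel) i j

def f5 (w : Equiv.Perm (Fin 4)) : ℤ :=
  [-6, -6, -3, -3, -3, -3, 6, 6, 3, 3, 3, 3, 3, 3, -3, -3, 0, 0, 3, 3, -3, -3, 0, 0].getD (rk w) 0
noncomputable def e5 : AA := mk f5
lemma ef5 : coeff e5 = f5 := coeff_mk _
lemma me5 (i j : ℕ) : mIIJ i j * e5 = ((-1) ^ i * (1) ^ i * (2) ^ j + (-1) ^ i * (2) ^ i * (1) ^ j +
    (1) ^ i * (2) ^ i * (-1) ^ j : ℤ) • e5 := m_fun ef5 (-1) (1) (2)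
  (by decide +kernel) (by decide +kernel) (by decide +kernel) i j

def f6 (w : Equiv.Perm (Fin 4)) : ℤ :=
  [2, -2, 1, -1, -1, 1, -2, 2, -1, 1, 1, -1, -1, 1, 1, -1, 2, -2, 1, -1, -1, 1, -2, 2].getD (rk w) 0
noncomputable def e6 : AA := mk f6
lemma ef6 : coeff e6 = f6 := coeff_mk _
lemma me6 (i j : ℕ) : mIIJ i j * e6 = ((-1) ^ i * (1) ^ i * (0) ^ j + (-1) ^ i * (0) ^ i * (1) ^ j +
    (1) ^ i * (0) ^ i * (-1) ^ j : ℤ) • e6 := m_fun ef6 (-1) (1) (0)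
  (by decide +kernel) (by decide +kernel) (by decide +kernel) i j

def f7 (w : Equiv.Perm (Fin 4)) : ℤ :=
  [-6, 2, -3, 1, 1, 5, 6, -2, 3, -1, -1, -5, 3, -1, -3, 1, 4, -4, -1, -5, 1, 5, -4, 4].getD (rk w) 0
noncomputable def e7 : AA := mk f7
lemma ef7 : coeff e7 = f7 := coeff_mk _
lemma me7 (i j : ℕ) : mIIJ i j * e7 = ((-1) ^ i * (1) ^ i * (-2) ^ j + (-1) ^ i * (-2) ^ i * (1) ^ j +
    (1) ^ i * (-2) ^ i * (-1) ^ j : ℤ) • e7 := m_fun ef7 (-1) (1) (-2)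
  (by decide +kernel) (by decide +kernel) (by decide +kernel) i j

def f8 (w : Equiv.Perm (Fin 4)) : ℤ :=
  [3, 1, -3, -1, -1, 1, -3, -1, 3, 1, 1, -1, 3, 1, -3, -1, -1, 1, 1, -1, -1, 1, 1, -1].getD (rk w) 0
noncomputable def e8 : AA := mk f8
lemma ef8 : coeff e8 = f8 := coeff_mk _
lemma me8 (i j : ℕ) : mIIJ i j * e8 = ((-1) ^ i * (-2) ^ i * (1) ^ j + (-1) ^ i * (1) ^ i * (-2) ^ j +
    (-2) ^ i * (1) ^ i * (-1) ^ j : ℤ) • e8 := m_fun ef8 (-1) (-2) (1)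
  (by decide +kernel) (by decide +kernel) (by decide +kernel) i j

def f9 (w : Equiv.Perm (Fin 4)) : ℤ :=
  [-1, 1, 1, -1, -1, 1, 1, -1, -1, 1, 1, -1, -1, 1, 1, -1, -1, 1, 1, -1, -1, 1, 1, -1].getD (rk w) 0
noncomputable def e9 : AA := mk f9
lemma ef9 : coeff e9 = f9 := coeff_mk _
lemma me9 (i j : ℕ) : mIIJ i j * e9 = ((-1) ^ i * (-2) ^ i * (-3) ^ j + (-1) ^ i * (-3) ^ i * (-2) ^ j +
    (-2) ^ i * (-3) ^ i * (-1) ^ j : ℤ) • e9 := m_fun ef9 (-1) (-2) (-3)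
  (by decide +kernel) (by decide +kernel) (by decide +kernel) i j

lemma resol_fun : ∀ w, 48 * bas w = (2) * f0 w + (-2) * f1 w + (-1) * f2 w + (2) * f3 w + (-1) * f4 w + (-1) * f5 w + (2) * f6 w + (-1) * f7 w + (2) * f8 w + (-2) * f9 w := by
  decide +kernel

lemma resol : (48 : ℤ) • (1 : AA) = (2 : ℤ) • e0 + (-2 : ℤ) • e1 + (-1 : ℤ) • e2 + (2 : ℤ) • e3 + (-1 : ℤ) • e4 + (-1 : ℤ) • e5 + (2 : ℤ) • e6 + (-1 : ℤ) • e7 + (2 : ℤ) • e8 + (-2 : ℤ) • e9 := by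
  refine coeff_ext _ _ fun w => ?_
  simp only [coeff_add'_s9, coeff_smul', coeff_one'_s9, ef0, ef1, ef2, ef3, ef4, ef5, ef6, ef7, ef8, ef9]
  exact resol_fun w

lemma key (i j : ℕ) (w) : 48 * coeff (mIIJ i j) w =
    (2) * (((1) ^ i * (2) ^ i * (3) ^ j + (1) ^ i * (3) ^ i * (2) ^ j + (2) ^ i * (3) ^ i * (1) ^ j) * f0 w) +
    (-2) * (((1) ^ i * (2) ^ i * (-1) ^ j + (1) ^ i * (-1) ^ i * (2) ^ j + (2) ^ i * (-1) ^ i * (1) ^ j) * f1 w) +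
    (-1) * (((1) ^ i * (-1) ^ i * (2) ^ j + (1) ^ i * (2) ^ i * (-1) ^ j + (-1) ^ i * (2) ^ i * (1) ^ j) * f2 w) +
    (2) * (((1) ^ i * (-1) ^ i * (0) ^ j + (1) ^ i * (0) ^ i * (-1) ^ j + (-1) ^ i * (0) ^ i * (1) ^ j) * f3 w) +
    (-1) * (((1) ^ i * (-1) ^ i * (-2) ^ j + (1) ^ i * (-2) ^ i * (-1) ^ j + (-1) ^ i * (-2) ^ i * (1) ^ j) * f4 w) +
    (-1) * (((-1) ^ i * (1) ^ i * (2) ^ j + (-1) ^ i * (2) ^ i * (1) ^ j + (1) ^ i * (2) ^ i * (-1) ^ j) * f5 w) +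
    (2) * (((-1) ^ i * (1) ^ i * (0) ^ j + (-1) ^ i * (0) ^ i * (1) ^ j + (1) ^ i * (0) ^ i * (-1) ^ j) * f6 w) +
    (-1) * (((-1) ^ i * (1) ^ i * (-2) ^ j + (-1) ^ i * (-2) ^ i * (1) ^ j + (1) ^ i * (-2) ^ i * (-1) ^ j) * f7 w) +
    (2) * (((-1) ^ i * (-2) ^ i * (1) ^ j + (-1) ^ i * (1) ^ i * (-2) ^ j + (-2) ^ i * (1) ^ i * (-1) ^ j) * f8 w) +
    (-2) * (((-1) ^ i * (-2) ^ i * (-3) ^ j + (-1) ^ i * (-3) ^ i * (-2) ^ j + (-2) ^ i * (-3) ^ i * (-1) ^ j) * f9 w) := by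
  have h : (48 : ℤ) • mIIJ i j = mIIJ i j * ((48 : ℤ) • 1) := by
    rw [mul_smul_comm, mul_one]
  rw [← coeff_smul', h, resol]
  simp only [mul_add, mul_smul_comm, coeff_add'_s9, coeff_smul', me0, ef0, me1, ef1, me2, ef2, me3, ef3, me4, ef4, me5, ef5, me6, ef6, me7, ef7, me8, ef8, me9, ef9]

lemma val_1 : f0 1 = 1 ∧ f1 1 = -3 ∧ f2 1 = -6 ∧ f3 1 = 2 ∧ f4 1 = -6 ∧ f5 1 = -6 ∧ f6 1 = 2 ∧ f7 1 = -6 ∧ f8 1 = 3 ∧ f9 1 = -1 := by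
  decide +kernel
lemma val_s1 : f0 s1 = 1 ∧ f1 s1 = -3 ∧ f2 s1 = -6 ∧ f3 s1 = 2 ∧ f4 s1 = -6 ∧ f5 s1 = 6 ∧ f6 s1 = -2 ∧ f7 s1 = 6 ∧ f8 s1 = -3 ∧ f9 s1 = 1 := by
  decide +kernel
lemma val_s12 : f0 s12 = 1 ∧ f1 s12 = -3 ∧ f2 s12 = 3 ∧ f3 s12 = -1 ∧ f4 s12 = 3 ∧ f5 s12 = 3 ∧ f6 s12 = -1 ∧ f7 s12 = 3 ∧ f8 s12 = 3 ∧ f9 s12 = -1 := by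
  decide +kernel
lemma val_s13 : f0 s13 = 1 ∧ f1 s13 = 1 ∧ f2 s13 = -2 ∧ f3 s13 = 2 ∧ f4 s13 = 6 ∧ f5 s13 = 6 ∧ f6 s13 = 2 ∧ f7 s13 = -2 ∧ f8 s13 = -1 ∧ f9 s13 = -1 := by
  decide +kernel
lemma val_s123 : f0 s123 = 1 ∧ f1 s123 = 1 ∧ f2 s123 = 1 ∧ f3 s123 = -1 ∧ f4 s123 = -3 ∧ f5 s123 = 3 ∧ f6 s123 = 1 ∧ f7 s123 = -1 ∧ f8 s123 = 1 ∧ f9 s123 = 1 := by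
  decide +kernel

theorem closed_forms_mIIJ (i j : ℕ) (hi : 1 ≤ i) (hj : 1 ≤ j) (hij : i ≠ j) :
    24 * coeff (mIIJ i j) 1
        = (1 + (-1 : ℤ) ^ j) *
            (6 ^ i + 2 ^ i * 3 ^ j + 2 ^ j * 3 ^ i
              + 9 * (-1 : ℤ) ^ i * (2 ^ i + 2 ^ j) + 9 * 2 ^ i) ∧
    24 * coeff (mIIJ i j) s1
        = (1 - (-1 : ℤ) ^ j) *
            (6 ^ i + 2 ^ i * 3 ^ j + 2 ^ j * 3 ^ i
              + 3 * (-1 : ℤ) ^ i * (2 ^ i + 2 ^ j) - 3 * 2 ^ i) ∧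
    24 * coeff (mIIJ i j) s12
        = (1 + (-1 : ℤ) ^ j) * (6 ^ i + 2 ^ i * 3 ^ j + 2 ^ j * 3 ^ i) ∧
    24 * coeff (mIIJ i j) s13
        = (1 + (-1 : ℤ) ^ j) *
            (6 ^ i + 2 ^ i * 3 ^ j + 2 ^ j * 3 ^ i
              - 3 * (-1 : ℤ) ^ i * (2 ^ i + 2 ^ j) - 3 * 2 ^ i) ∧
    24 * coeff (mIIJ i j) s123
        = (1 - (-1 : ℤ) ^ j) *
            (6 ^ i + 2 ^ i * 3 ^ j + 2 ^ j * 3 ^ i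
              - 3 * (-1 : ℤ) ^ i * (2 ^ i + 2 ^ j) + 3 * 2 ^ i) := by

  have p2 : ∀ n : ℕ, (-2 : ℤ) ^ n = (-1) ^ n * 2 ^ n := fun n => by rw [← mul_pow]; norm_num
  have p3 : ∀ n : ℕ, (-3 : ℤ) ^ n = (-1) ^ n * 3 ^ n := fun n => by rw [← mul_pow]; norm_num
  have p6 : (6 : ℤ) ^ i = 2 ^ i * 3 ^ i := by rw [← mul_pow]; norm_num
  have zi : (0 : ℤ) ^ i = 0 := zero_pow (by omega)
  have zj : (0 : ℤ) ^ j = 0 := zero_pow (by omega)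
  have ti : (-1 : ℤ) ^ i = 1 ∨ (-1 : ℤ) ^ i = -1 := neg_one_pow_eq_or ℤ i
  have tj : (-1 : ℤ) ^ j = 1 ∨ (-1 : ℤ) ^ j = -1 := neg_one_pow_eq_or ℤ j
  refine ⟨?_, ?_, ?_, ?_, ?_⟩
  · have h := key i j 1
    obtain ⟨v0, v1, v2, v3, v4, v5, v6, v7, v8, v9⟩ := val_1
    rw [v0, v1, v2, v3, v4, v5, v6, v7, v8, v9] at h
    simp only [p2, p3, zi, zj, one_pow] at h
    rw [p6]
    rcases ti with ti | ti <;> rcases tj with tj | tj <;> rw [tj] at h ⊢ <;>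
      rw [ti] at h <;> try rw [ti]
    all_goals linarith
  · have h := key i j s1
    obtain ⟨v0, v1, v2, v3, v4, v5, v6, v7, v8, v9⟩ := val_s1
    rw [v0, v1, v2, v3, v4, v5, v6, v7, v8, v9] at h
    simp only [p2, p3, zi, zj, one_pow] at h
    rw [p6]
    rcases ti with ti | ti <;> rcases tj with tj | tj <;> rw [tj] at h ⊢ <;>
      rw [ti] at h <;> try rw [ti]
    all_goals linarith
  · have h := key i j s12
    obtain ⟨v0, v1, v2, v3, v4, v5, v6, v7, v8, v9⟩ := val_s12
    rw [v0, v1, v2, v3, v4, v5, v6, v7, v8, v9] at h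
    simp only [p2, p3, zi, zj, one_pow] at h
    rw [p6]
    rcases ti with ti | ti <;> rcases tj with tj | tj <;> rw [tj] at h ⊢ <;>
      rw [ti] at h <;> try rw [ti]
    all_goals linarith
  · have h := key i j s13
    obtain ⟨v0, v1, v2, v3, v4, v5, v6, v7, v8, v9⟩ := val_s13
    rw [v0, v1, v2, v3, v4, v5, v6, v7, v8, v9] at h
    simp only [p2, p3, zi, zj, one_pow] at h
    rw [p6]
    rcases ti with ti | ti <;> rcases tj with tj | tj <;> rw [tj] at h ⊢ <;>
      rw [ti] at h <;> try rw [ti]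
    all_goals linarith
  · have h := key i j s123
    obtain ⟨v0, v1, v2, v3, v4, v5, v6, v7, v8, v9⟩ := val_s123
    rw [v0, v1, v2, v3, v4, v5, v6, v7, v8, v9] at h
    simp only [p2, p3, zi, zj, one_pow] at h
    rw [p6]
    rcases ti with ti | ti <;> rcases tj with tj | tj <;> rw [tj] at h ⊢ <;>
      rw [ti] at h <;> try rw [ti]
    all_goals linarith
end

section
/- In ℤS₄, for all integers i, j ≥ 1, the coefficients of m_{i+j,i} := Σ_{(u,v)} u^{i+j} v^i (sum over the six ordered pairs (u,v) of distinct elements of {L₂,L₃,L₄}) satisfy: 24·⟨1,m_{i+j,i}⟩ = (1+(−1)^j)(6^i·3^j + 6^i·2^j + 3^{i+j} + 3^i + (10+9·(−1)^i)(2^{i+j}+2^i) + 22·(−1)^i); 24·⟨s₁,m_{i+j,i}⟩ = (1−(−1)^j)(3^j·6^i + 2^j·6^i + 3^{i+j} + 3^i + (4+3·(−1)^i)·2^{i+j} + (4−3·(−1)^i)·2^i); 24·⟨s₁₂,m_{i+j,i}⟩ = (1+(−1)^j)(3^j·6^i + 2^j·6^i + 3^{i+j} + 3^i + 2^{i+j}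 + 2^i − 2·(−1)^i); 24·⟨s₁₃,m_{i+j,i}⟩ = (1+(−1)^j)(3^j·6^i + 2^j·6^i + 3^{i+j} + 3^i − (2+3·(−1)^i)(2^i+2^{i+j}) − 2·(−1)^i); 24·⟨s₁₂₃,m_{i+j,i}⟩ = (1−(−1)^j)(3^j·6^i + 2^j·6^i + 3^i + 3^{i+j} + 3·(−1)^i(2^i−2^{i+j}) − 2(2^i+2^{i+j})). -/
open MonoidAlgebra hiding coeff

/-- `m_{i+j,i} = m_{(i+j,i)}(L₁,L₂,L₃,L₄)`: the sum of `u^{i+j} v^i` over the six ordered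
pairs `(u,v)` of distinct elements of `{L₂,L₃,L₄}` (recall `L₁ = 0`). -/
noncomputable def mIJI (i j : ℕ) : MonoidAlgebra ℤ (Equiv.Perm (Fin 4)) :=
  L2 ^ (i + j) * L3 ^ i + L2 ^ (i + j) * L4 ^ i
    + L3 ^ (i + j) * L2 ^ i + L3 ^ (i + j) * L4 ^ i
    + L4 ^ (i + j) * L2 ^ i + L4 ^ (i + j) * L3 ^ i

/-- Contents (eigenvalues of `L₂, L₃, L₄`) of the ten standard tableaux of size 4. -/
def ctab : List (List ℤ) := [[1, 2, 3], [1, 2, -1], [1, -1, 2], [-1, 1, 2], [1, -1, 0], [-1, 1, 0], [1, -1, -2], [-1, 1, -2], [-1, -2, 1], [-1, -2, -3]]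

/-- 48 times the Young seminormal idempotents, coefficients listed in lexicographic order. -/
def etab : List (List ℤ) := [
    [2, 2, 2, 2, 2, 2, 2, 2, 2, 2, 2, 2, 2, 2, 2, 2, 2, 2, 2, 2, 2, 2, 2, 2],
    [6, -2, 6, -2, -2, -2, 6, -2, 6, -2, -2, -2, 6, -2, 6, -2, -2, -2, -2, -2, -2, -2, -2, -2],
    [6, 2, -3, -1, -1, 5, 6, 2, -3, -1, -1, 5, -3, -1, -3, -1, -4, -4, -1, 5, -1, 5, -4, -4],
    [6, 6, 3, 3, 3, 3, -6, -6, -3, -3, -3, -3, -3, -3, 3, 3, 0, 0, -3, -3, 3, 3, 0, 0],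
    [4, 4, -2, -2, -2, -2, 4, 4, -2, -2, -2, -2, -2, -2, -2, -2, 4, 4, -2, -2, -2, -2, 4, 4],
    [4, -4, 2, -2, -2, 2, -4, 4, -2, 2, 2, -2, -2, 2, 2, -2, 4, -4, 2, -2, -2, 2, -4, 4],
    [6, -6, -3, 3, 3, -3, 6, -6, -3, 3, 3, -3, -3, 3, -3, 3, 0, 0, 3, -3, 3, -3, 0, 0],
    [6, -2, 3, -1, -1, -5, -6, 2, -3, 1, 1, 5, -3, 1, 3, -1, -4, 4, 1, 5, -1, -5, 4, -4],
    [6, 2, -6, -2, -2, 2, -6, -2, 6, 2, 2, -2, 6, 2, -6, -2, -2, 2, 2, -2, -2, 2, 2, -2],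
    [2, -2, -2, 2, 2, -2, -2, 2, 2, -2, -2, 2, 2, -2, -2, 2, 2, -2, -2, 2, 2, -2, -2, 2]]

def cc (t : Fin 10) (k : ℕ) : ℤ := (ctab.getD t []).getD k 0

def pidx (w : Equiv.Perm (Fin 4)) : ℕ :=
  6 * (w 0).val + 2 * (if w 0 < w 1 then (w 1).val - 1 else (w 1).val) + (if w 3 < w 2 then 1 else 0)

def ee (t : Fin 10) (w : Equiv.Perm (Fin 4)) : ℤ := (etab.getD t []).getD (pidx w) 0

noncomputable def EE (t : Fin 10) : MonoidAlgebra ℤ (Equiv.Perm (Fin 4)) :=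
  MonoidAlgebra.ofCoeff (Finsupp.equivFunOnFinite.symm (ee t))

theorem EE_coeff (t : Fin 10) (w : Equiv.Perm (Fin 4)) : (EE t).coeff w = ee t w := rfl

theorem tab2 : ∀ (t : Fin 10) (w : Equiv.Perm (Fin 4)),
    ee t (Equiv.swap 0 1 * w) = cc t 0 * ee t w := by decide +kernel

theorem tab3 : ∀ (t : Fin 10) (w : Equiv.Perm (Fin 4)),
    ee t (Equiv.swap 0 2 * w) + ee t (Equiv.swap 1 2 * w) = cc t 1 * ee t w := by decide +kernel

theorem tab4 : ∀ (t : Fin 10) (w : Equiv.Perm (Fin 4)),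
    ee t (Equiv.swap 0 3 * w) + ee t (Equiv.swap 1 3 * w) + ee t (Equiv.swap 2 3 * w)
      = cc t 2 * ee t w := by decide +kernel

theorem tab1 : ∀ w : Equiv.Perm (Fin 4), ∑ t, ee t w = if 1 = w then 48 else 0 := by
  decide +kernel

theorem act2 (t : Fin 10) : L2 * EE t = cc t 0 • EE t := by
  ext w
  simp [-zsmul_eq_mul, L2, EE_coeff, tab2]

theorem act3 (t : Fin 10) : L3 * EE t = cc t 1 • EE t := by
  ext w
  simp [-zsmul_eq_mul, L3, add_mul, EE_coeff, tab3]

theorem act4 (t : Fin 10) : L4 * EE t = cc t 2 • EE t := by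
  ext w
  simp [-zsmul_eq_mul, L4, add_mul, EE_coeff, tab4]

theorem pow_act {x y : MonoidAlgebra ℤ (Equiv.Perm (Fin 4))} {c : ℤ} (h : x * y = c • y) (n : ℕ) :
    x ^ n * y = c ^ n • y := by
  induction n with
  | zero => simp
  | succ n ih => rw [pow_succ, mul_assoc, h, mul_smul_comm, ih, smul_smul, pow_succ, mul_comm]

theorem sum_EE : ∑ t, EE t = (48 : ℤ) • (1 : MonoidAlgebra ℤ (Equiv.Perm (Fin 4))) := by
  ext w
  have := tab1 w
  simp [MonoidAlgebra.one_def, EE_coeff, Finsupp.single_apply, this]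

def mc (i j : ℕ) (a b c : ℤ) : ℤ :=
  a ^ (i + j) * b ^ i + a ^ (i + j) * c ^ i + b ^ (i + j) * a ^ i + b ^ (i + j) * c ^ i
    + c ^ (i + j) * a ^ i + c ^ (i + j) * b ^ i

theorem m_act (i j : ℕ) (t : Fin 10) :
    mIJI i j * EE t = mc i j (cc t 0) (cc t 1) (cc t 2) • EE t := by
  simp only [mIJI, mc, add_mul, mul_assoc, pow_act (act2 t), pow_act (act3 t), pow_act (act4 t),
    mul_smul_comm, smul_smul, add_smul]
  simp only [mul_comm]

theorem m_coeff (i j : ℕ) (w : Equiv.Perm (Fin 4)) :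
    48 * coeff (mIJI i j) w = ∑ t, mc i j (cc t 0) (cc t 1) (cc t 2) * ee t w := by
  have h : (48 : ℤ) • mIJI i j = ∑ t, mc i j (cc t 0) (cc t 1) (cc t 2) • EE t := by
    simp only [← m_act, ← Finset.mul_sum, sum_EE, mul_smul_comm, mul_one]
  have h2 := congrArg (fun x => MonoidAlgebra.coeff x w) h
  simpa [-zsmul_eq_mul, EE_coeff, coeff] using h2

theorem ee_one : ∀ t, ee t 1 = ([2, 6, 6, 6, 4, 4, 6, 6, 6, 2] : List ℤ).getD t 0 := by decide +kernel

theorem ee_s1 : ∀ t, ee t s1 = ([2, 6, 6, -6, 4, -4, 6, -6, -6, -2] : List ℤ).getD t 0 := by decide +kernel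

theorem ee_s12 : ∀ t, ee t s12 = ([2, 6, -3, -3, -2, -2, -3, -3, 6, 2] : List ℤ).getD t 0 := by decide +kernel

theorem ee_s13 : ∀ t, ee t s13 = ([2, -2, 2, -6, 4, 4, -6, 2, -2, 2] : List ℤ).getD t 0 := by decide +kernel

theorem ee_s123 : ∀ t, ee t s123 = ([2, -2, -1, -3, -2, 2, 3, 1, 2, -2] : List ℤ).getD t 0 := by decide +kernel

set_option maxHeartbeats 4000000 in
theorem closed_forms_mIJI (i j : ℕ) (hi : 1 ≤ i) (hj : 1 ≤ j) :
    24 * coeff (mIJI i j) 1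
        = (1 + (-1 : ℤ) ^ j) *
            (6 ^ i * 3 ^ j + 6 ^ i * 2 ^ j + 3 ^ (i + j) + 3 ^ i
              + (10 + 9 * (-1 : ℤ) ^ i) * (2 ^ (i + j) + 2 ^ i) + 22 * (-1 : ℤ) ^ i) ∧
    24 * coeff (mIJI i j) s1
        = (1 - (-1 : ℤ) ^ j) *
            (3 ^ j * 6 ^ i + 2 ^ j * 6 ^ i + 3 ^ (i + j) + 3 ^ i
              + (4 + 3 * (-1 : ℤ) ^ i) * 2 ^ (i + j) + (4 - 3 * (-1 : ℤ) ^ i) * 2 ^ i) ∧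
    24 * coeff (mIJI i j) s12
        = (1 + (-1 : ℤ) ^ j) *
            (3 ^ j * 6 ^ i + 2 ^ j * 6 ^ i + 3 ^ (i + j) + 3 ^ i
              + 2 ^ (i + j) + 2 ^ i - 2 * (-1 : ℤ) ^ i) ∧
    24 * coeff (mIJI i j) s13
        = (1 + (-1 : ℤ) ^ j) *
            (3 ^ j * 6 ^ i + 2 ^ j * 6 ^ i + 3 ^ (i + j) + 3 ^ i
              - (2 + 3 * (-1 : ℤ) ^ i) * (2 ^ i + 2 ^ (i + j)) - 2 * (-1 : ℤ) ^ i) ∧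
    24 * coeff (mIJI i j) s123
        = (1 - (-1 : ℤ) ^ j) *
            (3 ^ j * 6 ^ i + 2 ^ j * 6 ^ i + 3 ^ i + 3 ^ (i + j)
              + 3 * (-1 : ℤ) ^ i * (2 ^ i - 2 ^ (i + j)) - 2 * (2 ^ i + 2 ^ (i + j))) := by
  have e6 : (6 : ℤ) ^ i = 2 ^ i * 3 ^ i := by rw [← mul_pow]; norm_num
  have n2 (n : ℕ) : (-2 : ℤ) ^ n = (-1) ^ n * 2 ^ n := by rw [← mul_pow]; norm_num
  have n3 (n : ℕ) : (-3 : ℤ) ^ n = (-1) ^ n * 3 ^ n := by rw [← mul_pow]; norm_num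
  have z1 : (0 : ℤ) ^ i = 0 := zero_pow (by omega)
  have h1 := m_coeff i j 1
  have h2 := m_coeff i j s1
  have h3 := m_coeff i j s12
  have h4 := m_coeff i j s13
  have h5 := m_coeff i j s123
  simp only [ee_one, ee_s1, ee_s12, ee_s13, ee_s123] at h1 h2 h3 h4 h5
  simp [Fin.sum_univ_succ, cc, ctab, mc, n2, n3, z1, pow_add] at h1 h2 h3 h4 h5
  simp only [e6, pow_add]
  rcases neg_one_pow_eq_or ℤ i with ha | ha <;> rcases neg_one_pow_eq_or ℤ j with hb | hb <;>
    simp only [ha, hb] at h1 h2 h3 h4 h5 ⊢ <;>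
    refine ⟨?_, ?_, ?_, ?_, ?_⟩ <;> apply mul_left_cancel₀ (two_ne_zero (α := ℤ))
  all_goals first
    | linear_combination h1
    | linear_combination h2
    | linear_combination h3
    | linear_combination h4
    | linear_combination h5
end

section
/- In ℤS₄, let i ≥ 1 and let j ≥ 2 be even with j ≠ i, and set m_{i,i,j} := L₂^iL₃^iL₄^j + L₂^iL₄^iL₃^j + L₃^iL₄^iL₂^j. If j ≥ 4, then all five coefficients ⟨1,m_{i,i,j}⟩, ⟨s₁,m_{i,i,j}⟩, ⟨s₁₂,m_{i,i,j}⟩, ⟨s₁₃,m_{i,i,j}⟩, ⟨s₁₂₃,m_{i,i,j}⟩ are even. If j = 2, then ⟨s₁₂,m_{i,i,2}⟩ is odd, while ⟨1,m_{i,i,2}⟩, ⟨s₁,m_{i,i,2}⟩, ⟨s₁₃,m_{i,i,2}⟩, ⟨s₁₂₃,m_{i,i,2}⟩ are all even. -/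
open MonoidAlgebra hiding coeff

namespace ParityAux

abbrev G := Equiv.Perm (Fin 4)
abbrev A := MonoidAlgebra (ZMod 2) G

noncomputable def E (l : List G) : A := (l.map (fun g => single g (1 : ZMod 2))).sum

def tog (w : G) (l : List G) : List G := if w ∈ l then l.erase w else w :: l

def ladd (l k : List G) : List G := l.foldr tog k

def lmul (l k : List G) : List G :=
  k.foldr (fun g acc => ladd (l.map (fun x => x * g)) acc) []

def lpow (l k : List G) : ℕ → List G
  | 0 => l
  | n + 1 => lmul (lpow l k n) k

lemma self_add (x : A) : x + x = 0 := by
  ext g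
  simp [CharTwo.add_self_eq_zero]

lemma E_tog (w : G) (l : List G) : E (tog w l) = single w 1 + E l := by
  unfold tog
  split_ifs with h
  · have h1 : E l = single w 1 + E (l.erase w) := by
      have := ((List.perm_cons_erase h).map (fun g => (single g (1 : ZMod 2) : A))).sum_eq
      simpa [E] using this
    rw [h1, ← add_assoc, self_add, zero_add]
  · simp [E]

lemma E_ladd (l k : List G) : E (ladd l k) = E l + E k := by
  induction l with
  | nil => simp [ladd, E]
  | cons a t ih =>
    have : ladd (a :: t) k = tog a (ladd t k) := rfl
    rw [this, E_tog, ih, ← add_assoc]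
    simp [E]

lemma E_map (l : List G) (g : G) : E (l.map (fun x => x * g)) = E l * single g 1 := by
  induction l with
  | nil => simp [E]
  | cons a t ih =>
    simp only [E, List.map_cons, List.sum_cons, add_mul, single_mul_single, mul_one] at ih ⊢
    rw [ih]

lemma E_lmul (l k : List G) : E (lmul l k) = E l * E k := by
  induction k with
  | nil => simp [lmul, E]
  | cons a t ih =>
    have : lmul l (a :: t) = ladd (l.map (fun x => x * a)) (lmul l t) := rfl
    rw [this, E_ladd, E_map, ih, ← mul_add]
    simp [E]

lemma E_lpow (l k : List G) (n : ℕ) : E (lpow l k n) = E l * E k ^ n := by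
  induction n with
  | zero => simp [lpow]
  | succ n ih => rw [lpow, E_lmul, ih, pow_succ, mul_assoc]

lemma E_coeff (l : List G) (w : G) : (E l).coeff w = (l.count w : ZMod 2) := by
  induction l with
  | nil => simp [E]
  | cons a t ih =>
    have h : E (a :: t) = single a 1 + E t := by simp [E]
    rw [h, coeff_add, Finsupp.add_apply, ih, coeff_single_apply, List.count_cons]
    by_cases hh : a = w <;> simp [hh, add_comm]

def l2 : List G := [Equiv.swap 0 1]
def l3 : List G := [Equiv.swap 0 2, Equiv.swap 1 2]
def l4 : List G := [Equiv.swap 0 3, Equiv.swap 1 3, Equiv.swap 2 3]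

/-- The model of `m_{i,i,j}` with exponents reduced. -/
def lm (i j : ℕ) : List G :=
  ladd (lpow (lpow (lpow [1] l2 i) l3 i) l4 j)
    (ladd (lpow (lpow (lpow [1] l2 i) l4 i) l3 j) (lpow (lpow (lpow [1] l3 i) l4 i) l2 j))

lemma E_one : E [1] = 1 := by simp [E, one_def]

noncomputable def P (i j : ℕ) : A :=
  E l2 ^ i * E l3 ^ i * E l4 ^ j + E l2 ^ i * E l4 ^ i * E l3 ^ j + E l3 ^ i * E l4 ^ i * E l2 ^ j

lemma E_lm (i j : ℕ) : E (lm i j) = P i j := by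
  simp only [lm, E_ladd, E_lpow, E_one, one_mul, P, add_assoc]

lemma coeff_mIIJ (i j : ℕ) (w : G) : ((coeff (mIIJ i j) w : ℤ) : ZMod 2) = (P i j).coeff w := by
  have h : mapRingHom G (Int.castRingHom (ZMod 2)) (mIIJ i j) = P i j := by
    simp only [mIIJ, P, map_add, map_mul, map_pow, L2, L3, L4, E, l2, l3, l4]
    simp [add_assoc]
  rw [← h]
  simp [coeff]

lemma E_eq (l k : List G) (h : ladd l k = []) : E l = E k := by
  have h1 := E_ladd l k
  rw [h] at h1
  have h2 : E l + E k = 0 := by rw [← h1]; simp [E]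
  calc E l = E l + E k + E k := by rw [add_assoc, self_add, add_zero]
    _ = E k := by rw [h2, zero_add]

lemma p2 : E l2 ^ 2 = 1 := by
  rw [← E_one, ← one_mul (E l2 ^ 2), ← E_one, ← E_lpow]
  exact E_eq _ _ (by decide +kernel)

lemma p3 : E l3 ^ 3 = E l3 := by
  rw [← one_mul (E l3 ^ 3), ← E_one, ← E_lpow]
  exact E_eq _ _ (by decide +kernel)

lemma p4 : E l4 ^ 5 = E l4 ^ 3 := by
  rw [← one_mul (E l4 ^ 5), ← one_mul (E l4 ^ 3), ← E_one, ← E_lpow, ← E_lpow]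
  exact E_eq _ _ (by decide +kernel)

lemma step (n : ℕ) : E l2 ^ (n + 5) = E l2 ^ (n + 3) ∧ E l3 ^ (n + 5) = E l3 ^ (n + 3) ∧
    E l4 ^ (n + 5) = E l4 ^ (n + 3) := by
  refine ⟨?_, ?_, ?_⟩
  · rw [show n + 5 = n + 3 + 2 by ring, pow_add, p2, mul_one]
  · rw [show n + 5 = n + 2 + 3 by ring, pow_add, p3, ← pow_succ]
  · rw [pow_add, p4, ← pow_add]

lemma red (i : ℕ) (hi : 1 ≤ i) : ∃ k, (k = 1 ∨ k = 2 ∨ k = 3 ∨ k = 4) ∧ (Even i → 4 ≤ i → k = 4) ∧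
    E l2 ^ i = E l2 ^ k ∧ E l3 ^ i = E l3 ^ k ∧ E l4 ^ i = E l4 ^ k := by
  induction i using Nat.strong_induction_on with
  | _ i ih =>
    by_cases h : i < 5
    · refine ⟨i, by omega, ?_, rfl, rfl, rfl⟩
      rintro - h4
      omega
    · obtain ⟨n, rfl⟩ : ∃ n, i = n + 5 := ⟨i - 5, by omega⟩
      obtain ⟨k, hk, he, h2, h3, h4⟩ := ih (n + 3) (by omega) (by omega)
      obtain ⟨s2, s3, s4⟩ := step n
      refine ⟨k, hk, ?_, s2.trans h2, s3.trans h3, s4.trans h4⟩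
      intro ev _
      have ev' : Even (n + 3) := by
        rw [Nat.even_iff] at ev ⊢; omega
      exact he ev' (by rw [Nat.even_iff] at ev'; omega)

lemma P4 (i j : ℕ) (hi : 1 ≤ i) (hj : 4 ≤ j) (he : Even j) : P i j = 0 := by
  obtain ⟨k, hk, -, h2, h3, h4⟩ := red i hi
  obtain ⟨m, -, hm, g2, g3, g4⟩ := red j (by omega)
  obtain rfl := hm he hj
  have : P i j = E (lm k 4) := by
    rw [E_lm]; simp only [P, h2, h3, h4, g2, g3, g4]
  rw [this]
  have h0 : lm k 4 = [] := by
    rcases hk with rfl | rfl | rfl | rfl <;> decide +kernel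
  rw [h0]; simp [E]

lemma P2 (i : ℕ) (hi : 1 ≤ i) : ∃ l : List G, P i 2 = E l ∧ l.count s12 % 2 = 1 ∧
    l.count 1 % 2 = 0 ∧ l.count s1 % 2 = 0 ∧ l.count s13 % 2 = 0 ∧ l.count s123 % 2 = 0 := by
  obtain ⟨k, hk, -, h2, h3, h4⟩ := red i hi
  refine ⟨lm k 2, ?_, ?_⟩
  · rw [E_lm]; simp only [P, h2, h3, h4]
  · rcases hk with rfl | rfl | rfl | rfl <;> decide +kernel

end ParityAux

open ParityAux in
theorem parity_mIIJ_j_even (i j : ℕ) (hi : 1 ≤ i) (hj : 2 ≤ j) (hjeven : Even j)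
    (hij : j ≠ i) :
    (4 ≤ j →
      Even (coeff (mIIJ i j) 1) ∧ Even (coeff (mIIJ i j) s1) ∧
        Even (coeff (mIIJ i j) s12) ∧ Even (coeff (mIIJ i j) s13) ∧
        Even (coeff (mIIJ i j) s123)) ∧
    (j = 2 →
      Odd (coeff (mIIJ i j) s12) ∧ Even (coeff (mIIJ i j) 1) ∧
        Even (coeff (mIIJ i j) s1) ∧ Even (coeff (mIIJ i j) s13) ∧
        Even (coeff (mIIJ i j) s123)) := by
  refine ⟨fun h4 => ?_, ?_⟩
  · have key : ∀ w, Even (coeff (mIIJ i j) w) := by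
      intro w
      rw [← ZMod.intCast_eq_zero_iff_even, coeff_mIIJ, P4 i j hi h4 hjeven]
      simp
    exact ⟨key _, key _, key _, key _, key _⟩
  · rintro rfl
    obtain ⟨l, hl, h1, h2, h3, h4, h5⟩ := P2 i hi
    have key : ∀ w, l.count w % 2 = 0 → Even (coeff (mIIJ i 2) w) := by
      intro w hw
      rw [← ZMod.intCast_eq_zero_iff_even, coeff_mIIJ, hl, E_coeff,
        ZMod.natCast_eq_zero_iff_even, Nat.even_iff]
      exact hw
    refine ⟨?_, key _ h2, key _ h3, key _ h4, key _ h5⟩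
    rw [← Int.not_even_iff_odd, ← ZMod.intCast_eq_zero_iff_even, coeff_mIIJ, hl, E_coeff,
        ZMod.natCast_eq_zero_iff_even, Nat.even_iff, h1]
    decide
end

section
/- In ℤS₄, for every odd integer i ≥ 1 the coefficient ⟨s₁,m_i⟩ is odd, and the coefficient ⟨s₁₂₃,m_i⟩ is odd if and only if i ≥ 3 (equivalently, ⟨s₁₂₃,m₁⟩ is even and ⟨s₁₂₃,m_i⟩ is odd for all odd i ≥ 3), where m_i := L₂^i + L₃^i + L₄^i. -/
open MonoidAlgebra

/-- Coefficients modulo 2 of powers of a sum of transpositions. -/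
def W (T : List (Equiv.Perm (Fin 4))) : ℕ → Equiv.Perm (Fin 4) → ZMod 2
  | 0, w => if w = 1 then 1 else 0
  | n + 1, w => (T.map fun t => W T n (t * w)).sum

lemma W_shift (T : List (Equiv.Perm (Fin 4))) (a b : ℕ) (h : ∀ w, W T a w = W T b w) (k : ℕ) :
    ∀ w, W T (a + k) w = W T (b + k) w := by
  induction k with
  | zero => exact h
  | succ k ih =>
    intro w
    rw [← add_assoc, ← add_assoc]
    simp only [W, ih]

lemma coeff_sw (a b : Fin 4) (h : MonoidAlgebra ℤ (Equiv.Perm (Fin 4))) (w : Equiv.Perm (Fin 4)) :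
    (single (Equiv.swap a b) (1 : ℤ) * h).coeff w = h.coeff (Equiv.swap a b * w) := by
  rw [MonoidAlgebra.coeff_single_mul_apply]
  simp

lemma coeff_one_W (T : List (Equiv.Perm (Fin 4))) (w : Equiv.Perm (Fin 4)) :
    ((((1 : MonoidAlgebra ℤ (Equiv.Perm (Fin 4))).coeff w : ℤ)) : ZMod 2) = W T 0 w := by
  rw [MonoidAlgebra.one_def]
  by_cases h : w = 1
  · subst h
    simp [W]
  · simp [W, h]

lemma c2 (n : ℕ) : ∀ w, ((L2 ^ n).coeff w : ZMod 2) = W [Equiv.swap 0 1] n w := by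
  induction n with
  | zero => exact coeff_one_W _
  | succ n ih =>
    intro w
    rw [pow_succ', L2, coeff_sw, ← L2, ih]
    simp [W]

lemma c3 (n : ℕ) : ∀ w, ((L3 ^ n).coeff w : ZMod 2) =
    W [Equiv.swap 0 2, Equiv.swap 1 2] n w := by
  induction n with
  | zero => exact coeff_one_W _
  | succ n ih =>
    intro w
    rw [pow_succ']
    nth_rw 1 [L3]
    rw [add_mul, coeff_add, Finsupp.add_apply, coeff_sw, coeff_sw]
    push_cast
    rw [ih, ih]
    simp [W]

lemma c4 (n : ℕ) : ∀ w, ((L4 ^ n).coeff w : ZMod 2) =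
    W [Equiv.swap 0 3, Equiv.swap 1 3, Equiv.swap 2 3] n w := by
  induction n with
  | zero => exact coeff_one_W _
  | succ n ih =>
    intro w
    rw [pow_succ']
    nth_rw 1 [L4]
    rw [add_mul, add_mul, coeff_add, coeff_add, Finsupp.add_apply, Finsupp.add_apply,
      coeff_sw, coeff_sw, coeff_sw]
    push_cast
    rw [ih, ih, ih]
    simp [W, add_assoc]

lemma cm (i : ℕ) (w : Equiv.Perm (Fin 4)) : ((_root_.coeff (mI i) w : ℤ) : ZMod 2) =
    W [Equiv.swap 0 1] i w + W [Equiv.swap 0 2, Equiv.swap 1 2] i w +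
    W [Equiv.swap 0 3, Equiv.swap 1 3, Equiv.swap 2 3] i w := by
  rw [← c2, ← c3, ← c4, _root_.coeff, mI, coeff_add, coeff_add, Finsupp.add_apply,
    Finsupp.add_apply]
  push_cast
  rfl

set_option maxRecDepth 100000 in
lemma p2 : ∀ w, W [Equiv.swap 0 1] 3 w = W [Equiv.swap 0 1] 1 w := by decide +kernel
set_option maxRecDepth 100000 in
lemma p3 : ∀ w, W [Equiv.swap 0 2, Equiv.swap 1 2] 3 w =
    W [Equiv.swap 0 2, Equiv.swap 1 2] 1 w := by decide +kernel
set_option maxRecDepth 100000 in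
lemma p4 : ∀ w, W [Equiv.swap 0 3, Equiv.swap 1 3, Equiv.swap 2 3] 5 w =
    W [Equiv.swap 0 3, Equiv.swap 1 3, Equiv.swap 2 3] 3 w := by decide +kernel

lemma stab (k : ℕ) (w : Equiv.Perm (Fin 4)) :
    ((_root_.coeff (mI (2 * k + 3)) w : ℤ) : ZMod 2) = ((_root_.coeff (mI 3) w : ℤ) : ZMod 2) := by
  induction k with
  | zero => rfl
  | succ k ih =>
    rw [← ih, cm, cm]
    have h2 := W_shift _ _ _ p2 (2 * k + 2) w
    have h3 := W_shift _ _ _ p3 (2 * k + 2) w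
    have h4 := W_shift _ _ _ p4 (2 * k) w
    rw [show 2 * (k + 1) + 3 = 3 + (2 * k + 2) by ring, h2, h3,
      show 3 + (2 * k + 2) = 5 + 2 * k by ring, h4,
      show 1 + (2 * k + 2) = 3 + 2 * k by ring, show 2 * k + 3 = 3 + 2 * k by ring]

theorem parity_mI_odd (i : ℕ) (hi : 1 ≤ i) (hiodd : Odd i) :
    Odd (_root_.coeff (mI i) s1) ∧ (Odd (_root_.coeff (mI i) s123) ↔ 3 ≤ i) := by
  rw [← ZMod.intCast_eq_one_iff_odd, ← ZMod.intCast_eq_one_iff_odd]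
  by_cases h : 3 ≤ i
  · obtain ⟨k, rfl⟩ : ∃ k, i = 2 * k + 3 := by
      obtain ⟨m, rfl⟩ := hiodd
      exact ⟨m - 1, by omega⟩
    rw [stab, stab, cm, cm]
    refine ⟨by decide +kernel, iff_of_true (by decide +kernel) h⟩
  · obtain rfl : i = 1 := by
      obtain ⟨m, rfl⟩ := hiodd
      omega
    rw [cm, cm]
    refine ⟨by decide +kernel, iff_of_false (by decide +kernel) h⟩
end

section
/- For all integers i ≥ 1 and w ≥ 0, the exponential Diophantine expression (2^{w+3} − 1)(6^i + 3^i + 2^i) + 6·2^{w+3} − 6^{w+3} − 3^{w+3} is never equal to 12 and never equal to −12. (Equivalently, the equation (2^{w+3}−1)(6^i+3^i+2^i) + 6·2^{w+3} − 6^{w+3} − 3^{w+3} = ±12 has no solutions in integers i ≥ 1, w ≥ 0.) -/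
theorem per_aux (b : ℤ) (hb : (b ^ 39) ≡ b ^ 3 [ZMOD 55188]) (r q : ℕ) :
    b ^ (3 + r + 36 * q) ≡ b ^ (3 + r) [ZMOD 55188] := by
  induction q with
  | zero => exact Int.ModEq.refl _
  | succ q ih =>
    have h : b ^ (3 + r + 36 * (q + 1)) = b ^ 39 * b ^ (r + 36 * q) := by
      rw [← pow_add]; congr 1; ring
    have h2 : b ^ (3 + r + 36 * q) = b ^ 3 * b ^ (r + 36 * q) := by
      rw [← pow_add]; congr 1; ring
    rw [h]
    refine (hb.mul_right _).trans ?_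
    rw [← h2]; exact ih

theorem red_aux (n : ℕ) (hn : 1 ≤ n) : ∃ m : ℕ, m < 38 ∧ (3 ≤ n → 2 ≤ m) ∧
    (2 : ℤ) ^ n ≡ 2 ^ (m + 1) [ZMOD 55188] ∧
    (3 : ℤ) ^ n ≡ 3 ^ (m + 1) [ZMOD 55188] ∧
    (6 : ℤ) ^ n ≡ 6 ^ (m + 1) [ZMOD 55188] := by
  by_cases h : n < 3
  · exact ⟨n - 1, by omega, by omega, by rw [Nat.sub_add_cancel hn],
      by rw [Nat.sub_add_cancel hn], by rw [Nat.sub_add_cancel hn]⟩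
  · have e : n = 3 + (n - 3) % 36 + 36 * ((n - 3) / 36) := by omega
    have e2 : (n - 3) % 36 + 2 + 1 = 3 + (n - 3) % 36 := by omega
    refine ⟨(n - 3) % 36 + 2, by omega, by omega, ?_, ?_, ?_⟩ <;> rw [e2] <;>
      conv_lhs => rw [e]
    · exact per_aux 2 (by decide +kernel) _ _
    · exact per_aux 3 (by decide +kernel) _ _
    · exact per_aux 6 (by decide +kernel) _ _

theorem fin_aux : ∀ m < 38, ∀ k < 38, 2 ≤ k →
    (((2 : ℤ) ^ (k + 1) - 1) * (6 ^ (m + 1) + 3 ^ (m + 1) + 2 ^ (m + 1))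
        + 6 * 2 ^ (k + 1) - 6 ^ (k + 1) - 3 ^ (k + 1)) % 55188 ≠ 12 % 55188 ∧
    (((2 : ℤ) ^ (k + 1) - 1) * (6 ^ (m + 1) + 3 ^ (m + 1) + 2 ^ (m + 1))
        + 6 * 2 ^ (k + 1) - 6 ^ (k + 1) - 3 ^ (k + 1)) % 55188 ≠ (-12) % 55188 := by
  decide +kernel

theorem exp_diophantine_no_solutions (i w : ℕ) (hi : 1 ≤ i) :
    ((2 : ℤ) ^ (w + 3) - 1) * (6 ^ i + 3 ^ i + 2 ^ i)
        + 6 * 2 ^ (w + 3) - 6 ^ (w + 3) - 3 ^ (w + 3) ≠ 12 ∧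
    ((2 : ℤ) ^ (w + 3) - 1) * (6 ^ i + 3 ^ i + 2 ^ i)
        + 6 * 2 ^ (w + 3) - 6 ^ (w + 3) - 3 ^ (w + 3) ≠ -12 := by
  obtain ⟨m, hm, -, m2, m3, m6⟩ := red_aux i hi
  obtain ⟨k, hk, hk2, k2, k3, k6⟩ := red_aux (w + 3) (by omega)
  have H := ((((k2.sub (Int.ModEq.refl 1)).mul ((m6.add m3).add m2)).add
    (k2.mul_left 6)).sub k6).sub k3
  obtain ⟨f1, f2⟩ := fin_aux m hm k hk (hk2 (by omega))
  constructor
  · intro h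
    rw [h] at H
    exact f1 H.symm
  · intro h
    rw [h] at H
    exact f2 H.symm
end

section
/- In ℤS₄, the five elements m_∅ := 1, m₁ := L₂ + L₃ + L₄, m₂ := L₂² + L₃² + L₄², m_{1,1} := L₂L₃ + L₂L₄ + L₃L₄, m₃ := L₂³ + L₃³ + L₄³ form a ℤ-module basis of the centre of ℤS₄ (Murphy's basis for n = 4): each of them lies in the centre, they are linearly independent over ℤ, and every element of the centre is a ℤ-linear combination of them. -/
open MonoidAlgebra

def clsS4 (g : Equiv.Perm (Fin 4)) : Fin 5 :=
  if g = 1 then 0 else if g * g * g = 1 then 2 else if g * g = 1 then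
    (if ∃ i, g i = i then 1 else 3) else 4

def repS4 : Fin 5 → Equiv.Perm (Fin 4) :=
  ![1, Equiv.swap 0 1, Equiv.swap 0 1 * Equiv.swap 1 2, Equiv.swap 0 1 * Equiv.swap 2 3,
    Equiv.swap 0 1 * Equiv.swap 1 2 * Equiv.swap 2 3]

set_option maxRecDepth 100000 in
theorem cls_commS4 : ∀ x h : Equiv.Perm (Fin 4), clsS4 (x * h) = clsS4 (h * x) := by decide +kernel

theorem cls_repS4 : ∀ x : Equiv.Perm (Fin 4), ∃ h, h * x * h⁻¹ = repS4 (clsS4 x) := by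
  decide +kernel

theorem cls_rep'S4 : ∀ i, clsS4 (repS4 i) = i := by decide +kernel

theorem m0S4 (g : Equiv.Perm (Fin 4)) :
    (1 : MonoidAlgebra ℤ (Equiv.Perm (Fin 4))).coeff g = ![1,0,0,0,0] (clsS4 g) := by
  simp only [one_def, coeff_single, Finsupp.single_apply]
  revert g; decide +kernel
theorem m1S4 (g : Equiv.Perm (Fin 4)) :
    (L2 + L3 + L4).coeff g = ![0,1,0,0,0] (clsS4 g) := by
  simp only [L2, L3, L4, coeff_add, coeff_single, Finsupp.add_apply, Finsupp.single_apply]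
  revert g; decide +kernel
theorem m2S4 (g : Equiv.Perm (Fin 4)) :
    (L2 ^ 2 + L3 ^ 2 + L4 ^ 2).coeff g = ![6,0,1,0,0] (clsS4 g) := by
  simp only [L2, L3, L4, pow_succ, pow_zero, one_mul, mul_add, add_mul, single_mul_single, mul_one,
    coeff_add, coeff_single, Finsupp.add_apply, Finsupp.single_apply]
  revert g; decide +kernel
theorem m3S4 (g : Equiv.Perm (Fin 4)) :
    (L2 * L3 + L2 * L4 + L3 * L4).coeff g = ![0,0,1,1,0] (clsS4 g) := by
  simp only [L2, L3, L4, pow_succ, pow_zero, one_mul, mul_add, add_mul, single_mul_single, mul_one,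
    coeff_add, coeff_single, Finsupp.add_apply, Finsupp.single_apply]
  revert g; decide +kernel
theorem m4S4 (g : Equiv.Perm (Fin 4)) :
    (L2 ^ 3 + L3 ^ 3 + L4 ^ 3).coeff g = ![0,5,0,0,1] (clsS4 g) := by
  simp only [L2, L3, L4, pow_succ, pow_zero, one_mul, mul_add, add_mul, single_mul_single, mul_one,
    coeff_add, coeff_single, Finsupp.add_apply, Finsupp.single_apply]
  revert g; decide +kernel

theorem centralS4 (w : MonoidAlgebra ℤ (Equiv.Perm (Fin 4))) (f : Fin 5 → ℤ)
    (hw : ∀ g, w.coeff g = f (clsS4 g)) :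
    w ∈ Subalgebra.center ℤ (MonoidAlgebra ℤ (Equiv.Perm (Fin 4))) := by
  rw [Subalgebra.mem_center_iff]
  intro b
  induction b using MonoidAlgebra.induction_linear with
  | zero => simp
  | add a b ha hb => rw [add_mul, mul_add, ha, hb]
  | single h r =>
    ext x
    simp only [coeff_single_mul_apply, coeff_mul_single_apply, hw]
    rw [cls_commS4, mul_comm]

theorem class_fnS4 (z : MonoidAlgebra ℤ (Equiv.Perm (Fin 4)))
    (hz : z ∈ Subalgebra.center ℤ (MonoidAlgebra ℤ (Equiv.Perm (Fin 4)))) (g) :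
    z.coeff g = z.coeff (repS4 (clsS4 g)) := by
  rw [Subalgebra.mem_center_iff] at hz
  obtain ⟨h, hh⟩ := cls_repS4 g
  have := congrArg (fun w => w.coeff (h * g)) (hz (single h 1))
  simp only [coeff_single_mul_apply, coeff_mul_single_apply, hh] at this
  simpa using this

theorem murphy_basis_S4 :
    let v : Fin 5 → MonoidAlgebra ℤ (Equiv.Perm (Fin 4)) :=
      ![1, L2 + L3 + L4, L2 ^ 2 + L3 ^ 2 + L4 ^ 2,
        L2 * L3 + L2 * L4 + L3 * L4, L2 ^ 3 + L3 ^ 3 + L4 ^ 3]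
    (∀ n, v n ∈ Subalgebra.center ℤ (MonoidAlgebra ℤ (Equiv.Perm (Fin 4)))) ∧
    LinearIndependent ℤ v ∧
    ∀ z ∈ Subalgebra.center ℤ (MonoidAlgebra ℤ (Equiv.Perm (Fin 4))),
      ∃ c : Fin 5 → ℤ, z = ∑ n, c n • v n := by
  intro v
  have key : ∀ (c : Fin 5 → ℤ) (g), (∑ n, c n • v n).coeff g =
      ![c 0 + 6 * c 2, c 1 + 5 * c 4, c 2 + c 3, c 3, c 4] (clsS4 g) := by
    intro c g
    have h0 := m0S4 g
    have h1 := m1S4 g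
    have h2 := m2S4 g
    have h3 := m3S4 g
    have h4 := m4S4 g
    have e : (∑ n, c n • v n).coeff g = c 0 * (v 0).coeff g + c 1 * (v 1).coeff g
        + c 2 * (v 2).coeff g + c 3 * (v 3).coeff g + c 4 * (v 4).coeff g := by
      simp only [Fin.sum_univ_five, coeff_add, coeff_smul, Finsupp.add_apply, Finsupp.smul_apply,
        smul_eq_mul]
    rw [e]
    change c 0 * (1 : MonoidAlgebra ℤ (Equiv.Perm (Fin 4))).coeff g
      + c 1 * (L2 + L3 + L4).coeff g + c 2 * (L2 ^ 2 + L3 ^ 2 + L4 ^ 2).coeff g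
      + c 3 * (L2 * L3 + L2 * L4 + L3 * L4).coeff g
      + c 4 * (L2 ^ 3 + L3 ^ 3 + L4 ^ 3).coeff g = _
    rw [h0, h1, h2, h3, h4]
    generalize clsS4 g = i
    fin_cases i <;> simp <;> ring
  refine ⟨?_, ?_, ?_⟩
  · intro n
    fin_cases n
    · exact centralS4 _ _ m0S4
    · exact centralS4 _ _ m1S4
    · exact centralS4 _ _ m2S4
    · exact centralS4 _ _ m3S4
    · exact centralS4 _ _ m4S4
  · rw [Fintype.linearIndependent_iff]
    intro c hc
    have hk : ∀ i, ![c 0 + 6 * c 2, c 1 + 5 * c 4, c 2 + c 3, c 3, c 4] i = 0 := by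
      intro i
      have := key c (repS4 i)
      rw [hc, cls_rep'S4] at this
      rw [← this]; simp
    have a0 := hk 0
    have a1 := hk 1
    have a2 := hk 2
    have a3 := hk 3
    have a4 := hk 4
    simp at a0 a1 a2 a3 a4
    intro i
    fin_cases i <;> simp <;> omega
  · intro z hz
    let a : Fin 5 → ℤ := fun i => z.coeff (repS4 i)
    refine ⟨![a 0 - 6 * (a 2 - a 3), a 1 - 5 * a 4, a 2 - a 3, a 3, a 4], ?_⟩
    ext g
    rw [key, class_fnS4 z hz g]
    change a (clsS4 g) = _
    generalize clsS4 g = i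
    fin_cases i <;> simp
end

section
/- In ℤS₄, for every odd integer i ≥ 1, the five elements m_∅ := 1, m₁ := L₂ + L₃ + L₄, m_{1,1} := L₂L₃ + L₂L₄ + L₃L₄, m_{1,1,1} := L₂L₃L₄, and m_{i,i,2} := L₂^iL₃^iL₄² + L₂^iL₄^iL₃² + L₃^iL₄^iL₂² form a ℤ-module basis of the centre of ℤS₄: each of them lies in the centre, they are linearly independent over ℤ, and every element of the centre is a ℤ-linear combination of them. (This gives an infinite family of monomial bases of Z(ℤS₄), one for each odd i.) -/
open MonoidAlgebra

def cl (g : Equiv.Perm (Fin 4)) : Fin 5 :=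
  if g = 1 then 0 else
  if g * g = 1 then (if ∃ x, g x = x then 1 else 2) else
  if ∃ x, g x = x then 3 else 4

def rp : Fin 5 → Equiv.Perm (Fin 4) :=
  ![1, Equiv.swap 0 1, Equiv.swap 0 1 * Equiv.swap 2 3, Equiv.swap 0 1 * Equiv.swap 1 2,
    Equiv.swap 0 1 * Equiv.swap 1 2 * Equiv.swap 2 3]

theorem cl_conj : ∀ h g : Equiv.Perm (Fin 4), cl (h⁻¹ * g) = cl (g * h⁻¹) := by decide +kernel
theorem cl_rp : ∀ j, cl (rp j) = j := by decide +kernel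
theorem ex_conj : ∀ g : Equiv.Perm (Fin 4), ∃ h, h * g * h⁻¹ = rp (cl g) := by
  decide +kernel

noncomputable def K (j : Fin 5) : MonoidAlgebra ℤ (Equiv.Perm (Fin 4)) :=
  ∑ g, single g (if cl g = j then 1 else 0)

theorem K_apply (j : Fin 5) (g) : (K j).coeff g = if cl g = j then 1 else 0 := by
  simp [K, Finsupp.finsetSum_apply, Finsupp.single_apply]

theorem K0 : (1 : MonoidAlgebra ℤ (Equiv.Perm (Fin 4))) = K 0 := by
  ext g
  rw [K_apply, MonoidAlgebra.one_def, coeff_single, Finsupp.single_apply]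
  revert g
  decide +kernel

theorem K1 : L2 + L3 + L4 = K 1 := by
  ext g
  simp only [L2, L3, L4, coeff_add, Finsupp.add_apply, K_apply, coeff_single, Finsupp.single_apply]
  revert g
  decide +kernel

theorem K23 : L2 * L3 + L2 * L4 + L3 * L4 = K 2 + K 3 := by
  ext g
  simp only [L2, L3, L4, coeff_add, Finsupp.add_apply, K_apply, coeff_single, Finsupp.single_apply,
    mul_add, coeff_mul_single_apply]
  revert g
  decide +kernel

theorem K4 : L2 * L3 * L4 = K 4 := by
  ext g
  simp only [L2, L3, L4, coeff_add, Finsupp.add_apply, K_apply, coeff_single, Finsupp.single_apply,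
    mul_add, coeff_mul_single_apply]
  revert g
  decide +kernel

theorem K_central (j : Fin 5) :
    K j ∈ Subalgebra.center ℤ (MonoidAlgebra ℤ (Equiv.Perm (Fin 4))) := by
  rw [Subalgebra.mem_center_iff]
  intro b
  induction b using MonoidAlgebra.induction_on with
  | of h =>
    ext g
    simp only [MonoidAlgebra.of_apply, coeff_mul_single_apply, coeff_single_mul_apply, K_apply,
      cl_conj, mul_one, one_mul]
  | add x y hx hy => rw [add_mul, mul_add, hx, hy]
  | smul r x hx => rw [smul_mul_assoc, mul_smul_comm, hx]

theorem central_apply {z : MonoidAlgebra ℤ (Equiv.Perm (Fin 4))}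
    (hz : z ∈ Subalgebra.center ℤ (MonoidAlgebra ℤ (Equiv.Perm (Fin 4)))) (g) :
    z.coeff g = z.coeff (rp (cl g)) := by
  obtain ⟨h, hh⟩ := ex_conj g
  rw [Subalgebra.mem_center_iff] at hz
  have := congrArg (fun x => x.coeff (h * g)) (hz (single h 1))
  simp only [coeff_mul_single_apply, coeff_single_mul_apply, mul_one, one_mul, hh,
    inv_mul_cancel_left] at this
  exact this

theorem central_eq {z : MonoidAlgebra ℤ (Equiv.Perm (Fin 4))}
    (hz : z ∈ Subalgebra.center ℤ (MonoidAlgebra ℤ (Equiv.Perm (Fin 4)))) :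
    z = ∑ j, z.coeff (rp j) • K j := by
  ext g
  rw [central_apply hz]
  simp only [coeff_sum, Finsupp.finsetSum_apply, coeff_smul, Finsupp.smul_apply, K_apply]
  simp

theorem L22 : L2 * L2 = 1 := by
  simp [L2, MonoidAlgebra.single_mul_single, MonoidAlgebra.one_def]

theorem L3_step_s19 (e : ℤ) : ((1 + 2 * e) • L3 + (2 * e) • L2) * (L3 * L3) =
    (1 + 2 * (1 + 4 * e)) • L3 + (2 * (1 + 4 * e)) • L2 := by
  have h1 : L3 * L3 * L3 = 3 • L3 + 2 • L2 := by
    ext g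
    simp only [L2, L3, L4, coeff_add, Finsupp.add_apply, coeff_single, Finsupp.single_apply,
      mul_add, coeff_mul_single_apply, coeff_smul, Finsupp.smul_apply]
    revert g
    decide +kernel
  have h2 : L2 * L3 * L3 = L3 + 2 • L2 := by
    ext g
    simp only [L2, L3, L4, coeff_add, Finsupp.add_apply, coeff_single, Finsupp.single_apply,
      mul_add, coeff_mul_single_apply, coeff_smul, Finsupp.smul_apply]
    revert g
    decide +kernel
  rw [← mul_assoc]
  simp only [add_mul, smul_mul_assoc, h1, h2]
  module

theorem L4_step_s19 (e t : ℤ) :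
    ((1 + 2 * t + 2 * e) • L4 + (2 * t) • (L2 + L3) + (2 * t - e) • K 4) * (L4 * L4) =
    (1 + 2 * (1 + 9 * t) + 2 * (1 + 4 * e)) • L4 + (2 * (1 + 9 * t)) • (L2 + L3)
      + (2 * (1 + 9 * t) - (1 + 4 * e)) • K 4 := by
  have h1 : L4 * L4 * L4 = 5 • L4 + 2 • (L2 + L3) + K 4 := by
    ext g
    simp only [L2, L3, L4, coeff_add, Finsupp.add_apply, coeff_single, Finsupp.single_apply,
      mul_add, coeff_mul_single_apply, coeff_smul, Finsupp.smul_apply, K_apply]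
    revert g
    decide +kernel
  have h2 : K 4 * L4 * L4 = 2 • L4 + 4 • (L2 + L3) + 6 • K 4 := by
    ext g
    simp only [L2, L3, L4, coeff_add, Finsupp.add_apply, coeff_single, Finsupp.single_apply,
      mul_add, coeff_mul_single_apply, coeff_smul, Finsupp.smul_apply, K_apply]
    revert g
    decide +kernel
  have h3 : (L2 + L3) * L4 * L4 = 2 • L4 + 3 • (L2 + L3) + 2 • K 4 := by
    ext g
    simp only [L2, L3, L4, coeff_add, Finsupp.add_apply, coeff_single, Finsupp.single_apply,
      mul_add, coeff_mul_single_apply, coeff_smul, Finsupp.smul_apply, K_apply]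
    revert g
    decide +kernel
  rw [← mul_assoc]
  generalize L2 + L3 = X at *
  simp only [add_mul, smul_mul_assoc, h1, h2, h3]
  module

theorem powers (k : ℕ) : ∃ e t : ℤ,
    L3 ^ (2 * k + 1) = (1 + 2 * e) • L3 + (2 * e) • L2 ∧
    L4 ^ (2 * k + 1) =
      (1 + 2 * t + 2 * e) • L4 + (2 * t) • (L2 + L3) + (2 * t - e) • K 4 := by
  induction k with
  | zero => exact ⟨0, 0, by simp, by simp⟩
  | succ k ih =>
    obtain ⟨e, t, h3, h4⟩ := ih
    refine ⟨1 + 4 * e, 1 + 9 * t, ?_, ?_⟩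
    · rw [← L3_step_s19, ← h3, ← pow_two, ← pow_add]; rfl
    · rw [← L4_step_s19, ← h4, ← pow_two, ← pow_add]; rfl

theorem L2_pow (k : ℕ) : L2 ^ (2 * k + 1) = L2 := by
  rw [pow_succ, pow_mul, pow_two, L22, one_pow, one_mul]

theorem m_formula (i : ℕ) (hi : Odd i) : ∃ d : ℤ,
    L2 ^ i * L3 ^ i * L4 ^ 2 + L2 ^ i * L4 ^ i * L3 ^ 2 + L3 ^ i * L4 ^ i * L2 ^ 2
      = (d - 3) • K 0 + d • K 3 + (d + 1) • K 2 := by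
  obtain ⟨k, rfl⟩ := hi
  obtain ⟨e, t, h3, h4⟩ := powers k
  refine ⟨3 + 6 * e + 12 * t * (e + 1), ?_⟩
  rw [L2_pow, h3, h4, pow_two, pow_two, pow_two, L22, mul_one, ← K4]
  have c1 : L2 * L3 * (L4 * L4) + L2 * L4 * (L3 * L3) + L3 * L4 = 3 • K 3 + 4 • K 2 := by
    ext g
    simp only [L2, L3, L4, coeff_add, Finsupp.add_apply, coeff_single, Finsupp.single_apply,
      mul_add, add_mul, ← mul_assoc, mul_smul_comm, smul_mul_assoc, coeff_mul_single_apply,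
      coeff_smul, Finsupp.smul_apply, K_apply, coeff_sub, Finsupp.sub_apply, mul_sub, sub_mul]
    revert g
    decide +kernel
  have ce : 2 • (L2 * (L3 + L2) * (L4 * L4)) + L2 * (2 • L4 - L2 * L3 * L4) * (L3 * L3) + L3 * (2 • L4 - L2 * L3 * L4) + 2 • ((L3 + L2) * L4) = 6 • (K 0 + K 3 + K 2) := by
    ext g
    simp only [L2, L3, L4, coeff_add, Finsupp.add_apply, coeff_single, Finsupp.single_apply,
      mul_add, add_mul, ← mul_assoc, mul_smul_comm, smul_mul_assoc, coeff_mul_single_apply,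
      coeff_smul, Finsupp.smul_apply, K_apply, coeff_sub, Finsupp.sub_apply, mul_sub, sub_mul]
    revert g
    decide +kernel
  have ct : L2 * (L4 + (L2 + L3) + L2 * L3 * L4) * (L3 * L3) + L3 * (L4 + (L2 + L3) + L2 * L3 * L4) = 6 • (K 0 + K 3 + K 2) := by
    ext g
    simp only [L2, L3, L4, coeff_add, Finsupp.add_apply, coeff_single, Finsupp.single_apply,
      mul_add, add_mul, ← mul_assoc, mul_smul_comm, smul_mul_assoc, coeff_mul_single_apply,
      coeff_smul, Finsupp.smul_apply, K_apply, coeff_sub, Finsupp.sub_apply, mul_sub, sub_mul]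
    revert g
    decide +kernel
  have cee : (L3 + L2) * (2 • L4 - L2 * L3 * L4) = 0 := by
    ext g
    simp only [L2, L3, L4, coeff_add, Finsupp.add_apply, coeff_single, Finsupp.single_apply,
      mul_add, add_mul, ← mul_assoc, mul_smul_comm, smul_mul_assoc, coeff_mul_single_apply,
      coeff_smul, Finsupp.smul_apply, K_apply, coeff_sub, Finsupp.sub_apply, mul_sub, sub_mul]
    revert g
    decide +kernel
  have cet : (L3 + L2) * (L4 + (L2 + L3) + L2 * L3 * L4) = 3 • (K 0 + K 3 + K 2) := by
    ext g
    simp only [L2, L3, L4, coeff_add, Finsupp.add_apply, coeff_single, Finsupp.single_apply,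
      mul_add, add_mul, ← mul_assoc, mul_smul_comm, smul_mul_assoc, coeff_mul_single_apply,
      coeff_smul, Finsupp.smul_apply, K_apply, coeff_sub, Finsupp.sub_apply, mul_sub, sub_mul]
    revert g
    decide +kernel
  have e3 : (1 + 2 * e) • L3 + (2 * e) • L2 = L3 + (2 * e) • (L3 + L2) := by module
  have e4 : (1 + 2 * t + 2 * e) • L4 + (2 * t) • (L2 + L3) + (2 * t - e) • (L2 * L3 * L4)
      = L4 + e • (2 • L4 - L2 * L3 * L4) + (2 * t) • (L4 + (L2 + L3) + L2 * L3 * L4) := by module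
  rw [e3, e4]
  generalize (L3 + L2) = A at *
  generalize (2 • L4 - L2 * L3 * L4) = B at *
  generalize (L4 + (L2 + L3) + L2 * L3 * L4) = D at *
  have key : L2 * (L3 + (2 * e) • A) * (L4 * L4)
      + L2 * (L4 + e • B + (2 * t) • D) * (L3 * L3)
      + (L3 + (2 * e) • A) * (L4 + e • B + (2 * t) • D)
      = (L2 * L3 * (L4 * L4) + L2 * L4 * (L3 * L3) + L3 * L4)
      + e • (2 • (L2 * A * (L4 * L4)) + L2 * B * (L3 * L3) + L3 * B + 2 • (A * L4))
      + (2 * t) • (L2 * D * (L3 * L3) + L3 * D)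
      + (2 * e * e) • (A * B) + (2 * e * (2 * t)) • (A * D) := by
    simp only [mul_add, add_mul, mul_smul_comm, smul_mul_assoc]
    module
  rw [key, c1, ce, ct, cee, cet]
  module

theorem monomial_basis_S4_family (i : ℕ) (hi : 1 ≤ i) (hiodd : Odd i) :
    let v : Fin 5 → MonoidAlgebra ℤ (Equiv.Perm (Fin 4)) :=
      ![1, L2 + L3 + L4, L2 * L3 + L2 * L4 + L3 * L4, L2 * L3 * L4,
        L2 ^ i * L3 ^ i * L4 ^ 2 + L2 ^ i * L4 ^ i * L3 ^ 2 + L3 ^ i * L4 ^ i * L2 ^ 2]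
    (∀ n, v n ∈ Subalgebra.center ℤ (MonoidAlgebra ℤ (Equiv.Perm (Fin 4)))) ∧
    LinearIndependent ℤ v ∧
    ∀ z ∈ Subalgebra.center ℤ (MonoidAlgebra ℤ (Equiv.Perm (Fin 4))),
      ∃ c : Fin 5 → ℤ, z = ∑ n, c n • v n := by
  intro v
  obtain ⟨d, hd⟩ := m_formula i hiodd
  have hv : v = ![K 0, K 1, K 2 + K 3, K 4, (d - 3) • K 0 + d • K 3 + (d + 1) • K 2] := by
    simp only [v]
    rw [hd, K23, K4, K1, K0]
  clear_value v
  subst hv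
  refine ⟨?_, ?_, ?_⟩
  · intro n
    have a := K_central
    fin_cases n
    · exact a 0
    · exact a 1
    · exact add_mem (a 2) (a 3)
    · exact a 4
    · exact add_mem (add_mem (Subalgebra.smul_mem _ (a 0) _) (Subalgebra.smul_mem _ (a 3) _))
        (Subalgebra.smul_mem _ (a 2) _)
  · rw [Fintype.linearIndependent_iff]
    intro c hc
    have h : ∀ j, _ := fun j => congrArg (fun x => x.coeff (rp j)) hc
    simp only [Fin.sum_univ_five, coeff_add, Finsupp.add_apply, coeff_smul, Finsupp.smul_apply,
      Matrix.cons_val, K_apply, cl_rp, coeff_zero, Finsupp.zero_apply, smul_eq_mul] at h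
    have h0 := h 0
    have h1 := h 1
    have h2 := h 2
    have h3 := h 3
    have h4 := h 4
    simp at h0 h1 h2 h3 h4
    have x4 : c 4 = 0 := by linear_combination h2 - h3
    rw [x4] at h0 h2
    intro j
    fin_cases j
    · simpa using h0
    · exact h1
    · simpa using h2
    · exact h4
    · exact x4
  · intro z hz
    have := central_eq hz
    obtain ⟨f, hf⟩ : ∃ f : Fin 5 → ℤ, z = ∑ j, f j • K j := ⟨_, this⟩
    refine ⟨![f 0 - (d - 3) * (f 2 - f 3), f 1, f 3 - d * (f 2 - f 3), f 4, f 2 - f 3], ?_⟩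
    rw [hf]
    simp only [Fin.sum_univ_five, Matrix.cons_val]
    module
end
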